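/- arXiv:1006.2416 — 3 statements merged into one kernel-verified Lean document; each statement's English description precedes it below -/
import Mathlib

section
/- (Kleinschmidt–Onn) Let k ≥ 1 and let P ⊆ (Fin d → ℝ) be the convex hull of a nonempty finite set S of integer points all of whose coordinates lie in {0, 1, …, k} (a lattice polytope contained in [0,k]^d). Then any two extreme points of P are joined by a path in the graph G(P) of length at most k · d. -/
open scoped BigOperators

noncomputable section

/-- Adjacency in the graph of a convex set `P`: two distinct extreme points whose closed
segment is a face of `P`. -/
def PolyAdj {E : Type*} [AddCommGroup E] [Module ℝ E] (P : Set E) (a b : E) : Prop :=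
  a ≠ b ∧ a ∈ Set.extremePoints ℝ P ∧ b ∈ Set.extremePoints ℝ P ∧
    IsExtreme ℝ P (segment ℝ a b)

/-- A path of length `L` in the graph of `P` from `a` to `b`. -/
def HasPathOfLength {E : Type*} [AddCommGroup E] [Module ℝ E] (P : Set E) (a b : E)
    (L : ℕ) : Prop :=
  ∃ f : ℕ → E, f 0 = a ∧ f L = b ∧ ∀ i < L, PolyAdj P (f i) (f (i + 1))

open Set

section Faces

variable {E : Type*} [AddCommGroup E] [Module ℝ E]

theorem isExtreme_convexHull_filter (S : Finset E) (h : E →ₗ[ℝ] ℝ) (c : ℝ)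
    (hc : ∀ s ∈ S, c ≤ h s) :
    IsExtreme ℝ (convexHull ℝ (S : Set E))
      (convexHull ℝ ((S.filter fun s => h s = c : Finset E) : Set E)) := by
  have hP : ∀ x ∈ convexHull ℝ (S : Set E), c ≤ h x := fun x hx =>
    convexHull_min (t := {x | c ≤ h x}) hc (convex_halfSpace_ge h.isLinear c) hx
  have hF : ∀ x ∈ convexHull ℝ ((S.filter fun s => h s = c : Finset E) : Set E), h x = c :=
    fun x hx => convexHull_min (t := {x | h x = c})
      (fun s hs => (Finset.mem_filter.1 hs).2) (convex_hyperplane h.isLinear c) hx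
  refine ⟨convexHull_mono (Finset.coe_subset.2 (Finset.filter_subset _ _)), ?_⟩
  rintro x hx y hy z hz ⟨α, β, hα, hβ, hαβ, rfl⟩
  have hxc : h x = c := by
    have h1 := hF _ hz
    have h2 := hP x hx
    have h3 := hP y hy
    simp only [map_add, map_smul, smul_eq_mul] at h1
    have hβ' : β = 1 - α := by linarith
    subst hβ'
    nlinarith
  obtain ⟨w, hw, hw1, rfl⟩ := Finset.mem_convexHull'.1 hx
  have hzero : ∑ s ∈ S, w s * (h s - c) = 0 := by
    simp only [mul_sub, Finset.sum_sub_distrib, ← Finset.sum_mul, hw1]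
    simpa [sub_eq_zero] using hxc
  have hsupp : ∀ s ∈ S, w s ≠ 0 → h s = c := by
    intro s hs hne
    have := (Finset.sum_eq_zero_iff_of_nonneg
      (fun s hs => mul_nonneg (hw s hs) (sub_nonneg.2 (hc s hs)))).1 hzero s hs
    exact sub_eq_zero.1 ((mul_eq_zero.1 this).resolve_left hne)
  refine Finset.mem_convexHull'.2 ⟨w, fun s hs => hw s (Finset.mem_filter.1 hs).1, ?_, ?_⟩
  · rw [Finset.sum_filter_of_ne hsupp, hw1]
  · exact Finset.sum_filter_of_ne fun s hs hne => hsupp s hs fun h0 => hne (by simp [h0])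

theorem PolyAdj.of_isExtreme {P F : Set E} (hF : IsExtreme ℝ P F) {a b : E}
    (hab : PolyAdj F a b) : PolyAdj P a b :=
  ⟨hab.1, hF.extremePoints_subset_extremePoints hab.2.1,
    hF.extremePoints_subset_extremePoints hab.2.2.1, hF.trans hab.2.2.2⟩

theorem PolyAdj.symm {P : Set E} {a b : E} (hab : PolyAdj P a b) : PolyAdj P b a :=
  ⟨hab.1.symm, hab.2.2.1, hab.2.1, segment_symm ℝ a b ▸ hab.2.2.2⟩

namespace HasPathOfLength

theorem refl (P : Set E) (a : E) : HasPathOfLength P a a 0 :=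
  ⟨fun _ => a, rfl, rfl, fun i hi => absurd hi (Nat.not_lt_zero i)⟩

theorem of_isExtreme {P F : Set E} (hF : IsExtreme ℝ P F) {a b : E} {L : ℕ} :
    HasPathOfLength F a b L → HasPathOfLength P a b L :=
  fun ⟨f, h0, hL, hf⟩ => ⟨f, h0, hL, fun i hi => (hf i hi).of_isExtreme hF⟩

theorem symm {P : Set E} {a b : E} {L : ℕ} :
    HasPathOfLength P a b L → HasPathOfLength P b a L := by
  rintro ⟨f, h0, hL, hf⟩
  refine ⟨fun i => f (L - i), by simpa using hL, by simpa using h0, fun i hi => ?_⟩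
  have := (hf (L - (i + 1)) (by omega)).symm
  rwa [show L - (i + 1) + 1 = L - i by omega] at this

theorem trans {P : Set E} {a b c : E} {L M : ℕ} :
    HasPathOfLength P a b L → HasPathOfLength P b c M → HasPathOfLength P a c (L + M) := by
  rintro ⟨f, f0, fL, hf⟩ ⟨g, g0, gM, hg⟩
  refine ⟨fun i => if i < L then f i else g (i - L), ?_, by simp [gM], fun i hi => ?_⟩
  · by_cases hL : 0 < L
    · simpa [hL] using f0
    · obtain rfl : L = 0 := by omega
      simp [g0, ← fL, f0]
  · rcases lt_trichotomy (i + 1) L with h | h | h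
    · simpa [h, show i < L by omega] using hf i (by omega)
    · have := hf i (by omega)
      rw [h, fL, ← g0] at this
      simpa [h, show i < L by omega] using this
    · have := hg (i - L) (by omega)
      rw [show i - L + 1 = i + 1 - L by omega] at this
      simpa [show ¬ i < L by omega, show ¬ i + 1 < L by omega] using this

theorem of_polyAdj {P : Set E} {a b : E} (h : PolyAdj P a b) : HasPathOfLength P a b 1 := by
  refine ⟨fun i => if i = 0 then a else b, by simp, by simp, fun i hi => ?_⟩
  obtain rfl : i = 0 := by omega
  simpa using h

end HasPathOfLength

/-- Tilting `φ` along `g` until it supports `S` at `a` and at a further point of `S`. -/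
theorem exists_tilt (S : Finset E) {a : E} (g φ : E →ₗ[ℝ] ℝ)
    (hg : ∀ s ∈ S, s ≠ a → g a < g s) (hS : ∃ s ∈ S, s ≠ a) :
    ∃ m : ℝ, (∃ s ∈ S, s ≠ a ∧ φ s - φ a = m * (g s - g a)) ∧
      ∀ s ∈ S, m * (g s - g a) ≤ φ s - φ a := by
  classical
  obtain ⟨s₁, hs₁, hne₁⟩ := hS
  obtain ⟨s₀, hs₀, hmin⟩ := (S.erase a).exists_min_image
    (fun s => (φ s - φ a) / (g s - g a)) ⟨s₁, Finset.mem_erase.2 ⟨hne₁, hs₁⟩⟩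
  have hs₀' := Finset.mem_erase.1 hs₀
  refine ⟨(φ s₀ - φ a) / (g s₀ - g a), ⟨s₀, hs₀'.2, hs₀'.1, ?_⟩, fun s hs => ?_⟩
  · rw [div_mul_cancel₀ _ (sub_pos.2 (hg s₀ hs₀'.2 hs₀'.1)).ne']
  · by_cases hsa : s = a
    · simp [hsa]
    · rw [← le_div_iff₀ (sub_pos.2 (hg s hs hsa))]
      exact hmin s (Finset.mem_erase.2 ⟨hsa, hs⟩)

end Faces

section Edges

variable {E : Type*} [AddCommGroup E] [Module ℝ E] [TopologicalSpace E]
  [IsTopologicalAddGroup E] [ContinuousSMul ℝ E] [LocallyConvexSpace ℝ E] [T2Space E]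

theorem exists_forall_lt_of_mem_extremePoints (S : Finset E) {a : E}
    (ha : a ∈ (convexHull ℝ (S : Set E)).extremePoints ℝ) :
    ∃ g : StrongDual ℝ E, ∀ s ∈ S, s ≠ a → g a < g s := by
  have hnot : a ∉ convexHull ℝ ((S : Set E) \ {a}) := fun hmem =>
    ((convex_convexHull ℝ _).mem_extremePoints_iff_mem_sdiff_convexHull_sdiff.1 ha).2
      (convexHull_mono (sdiff_subset_sdiff_left (subset_convexHull ℝ _)) hmem)
  obtain ⟨g, u, hgu, hu⟩ := geometric_hahn_banach_point_closed (convex_convexHull ℝ _)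
    (Set.Finite.isClosed_convexHull ℝ S.finite_toSet.sdiff) hnot
  exact ⟨g, fun s hs hsa => hgu.trans (hu s (subset_convexHull ℝ _ ⟨hs, hsa⟩))⟩

/-- If all points of `S` lie on a ray from `a`, then `a` has a neighbour in `convexHull ℝ S`. -/
theorem exists_polyAdj_of_collinear (S : Finset E) {a : E}
    (ha : a ∈ (convexHull ℝ (S : Set E)).extremePoints ℝ) (g : StrongDual ℝ E)
    (hg : ∀ s ∈ S, s ≠ a → g a < g s) (hS : ∃ s ∈ S, s ≠ a)
    (hφ : ∀ φ : StrongDual ℝ E, ∃ m : ℝ, ∀ s ∈ S, φ s - φ a = m * (g s - g a)) :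
    ∃ b ∈ S, PolyAdj (convexHull ℝ (S : Set E)) a b := by
  obtain ⟨s₁, hs₁, hne₁⟩ := hS
  obtain ⟨b, hb, hmax⟩ := S.exists_max_image g ⟨s₁, hs₁⟩
  have hab : g a < g b := (hg s₁ hs₁ hne₁).trans_le (hmax s₁ hs₁)
  have hne : a ≠ b := fun h => hab.ne (by rw [h])
  have haS : a ∈ S := extremePoints_convexHull_subset ha
  have hpos : 0 < g b - g a := sub_pos.2 hab
  have hray : ∀ s ∈ S, s = a + ((g s - g a) / (g b - g a)) • (b - a) := by
    intro s hs
    refine (SeparatingDual.eq_iff_forall_dual_eq (R := ℝ)).2 fun φ => ?_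
    obtain ⟨m, hm⟩ := hφ φ
    simp only [map_add, map_smul, map_sub, smul_eq_mul, hm b hb]
    field_simp
    linarith [hm s hs]
  have hga : ∀ s ∈ S, g a ≤ g s := fun s hs => by
    by_cases h : s = a
    · rw [h]
    · exact (hg s hs h).le
  have hseg : convexHull ℝ (S : Set E) = segment ℝ a b := by
    refine (convexHull_min (fun s hs => ?_) (convex_segment a b)).antisymm
      (segment_subset_convexHull haS hb)
    rw [segment_eq_image']
    exact ⟨_, ⟨div_nonneg (sub_nonneg.2 (hga s hs)) hpos.le,
      (div_le_one hpos).2 (sub_le_sub_right (hmax s hs) _)⟩, (hray s hs).symm⟩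
  have hbext : b ∈ (convexHull ℝ (S : Set E)).extremePoints ℝ := by
    have hface := isExtreme_convexHull_filter S (-(g : E →ₗ[ℝ] ℝ)) (-g b)
      (fun s hs => neg_le_neg (hmax s hs))
    have hsing : (S.filter fun s => (-(g : E →ₗ[ℝ] ℝ)) s = -g b) = {b} := by
      ext s
      simp only [Finset.mem_filter, Finset.mem_singleton]
      constructor
      · rintro ⟨hs, hgs⟩
        have hgs' : g s = g b := by simpa using hgs
        rw [hray s hs, hgs', div_self hpos.ne', one_smul, add_sub_cancel]
      · rintro rfl
        exact ⟨hb, rfl⟩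
    rw [hsing, Finset.coe_singleton, convexHull_singleton] at hface
    exact isExtreme_singleton.1 hface
  exact ⟨b, hb, hne, ha, hbext, hseg ▸ IsExtreme.rfl⟩

/-- The improving-edge property underlying the simplex method. -/
theorem exists_polyAdj_lt (ℓ : StrongDual ℝ E) (S : Finset E) {a : E}
    (ha : a ∈ (convexHull ℝ (S : Set E)).extremePoints ℝ) (hlt : ∃ s ∈ S, ℓ s < ℓ a) :
    ∃ b, PolyAdj (convexHull ℝ (S : Set E)) a b ∧ ℓ b < ℓ a := by
  induction S using Finset.strongInduction with
  | H S ih =>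
  have haS : a ∈ S := extremePoints_convexHull_subset ha
  by_cases H : ∃ S' ⊂ S, IsExtreme ℝ (convexHull ℝ (S : Set E)) (convexHull ℝ (S' : Set E)) ∧
      a ∈ S' ∧ ∃ s ∈ S', ℓ s < ℓ a
  · obtain ⟨S', hss, hface, haS', hs⟩ := H
    obtain ⟨b, hadj, hb⟩ := ih S' hss
      (inter_extremePoints_subset_extremePoints_of_subset hface.subset
        ⟨subset_convexHull ℝ _ haS', ha⟩) hs
    exact ⟨b, hadj.of_isExtreme hface, hb⟩
  obtain ⟨g, hg⟩ := exists_forall_lt_of_mem_extremePoints S ha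
  obtain ⟨s₁, hs₁, hlt₁⟩ := hlt
  have hne₁ : s₁ ≠ a := fun h => hlt₁.ne (by rw [h])
  have rigid : ∀ (φ : StrongDual ℝ E) (m : ℝ), (∀ s ∈ S, m * (g s - g a) ≤ φ s - φ a) →
      (∃ s ∈ S, ℓ s < ℓ a ∧ φ s - φ a = m * (g s - g a)) →
      ∀ s ∈ S, φ s - φ a = m * (g s - g a) := by
    rintro φ m hle ⟨s₀, hs₀, hlt₀, heq₀⟩
    have hval : ∀ s, ((φ - m • g : StrongDual ℝ E) : E →ₗ[ℝ] ℝ) s = φ s - m * g s :=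
      fun s => by simp
    have hface := isExtreme_convexHull_filter S ((φ - m • g : StrongDual ℝ E) : E →ₗ[ℝ] ℝ)
      (φ a - m * g a) (fun s hs => by rw [hval]; linarith [hle s hs])
    by_contra! hcon
    obtain ⟨s, hs, hsne⟩ := hcon
    refine H ⟨_, Finset.filter_ssubset.2 ⟨s, hs, fun h => hsne ?_⟩, hface,
      Finset.mem_filter.2 ⟨haS, hval a⟩, s₀, Finset.mem_filter.2 ⟨hs₀, ?_⟩, hlt₀⟩
    · rw [hval] at h
      linarith
    · rw [hval]
      linarith
  have hdown : ∀ s ∈ S, s ≠ a → ℓ s < ℓ a := by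
    obtain ⟨m, ⟨s₀, hs₀, hne₀, heq₀⟩, hle⟩ :=
      exists_tilt S (g : E →ₗ[ℝ] ℝ) (ℓ : E →ₗ[ℝ] ℝ) hg ⟨s₁, hs₁, hne₁⟩
    simp only [ContinuousLinearMap.coe_coe] at heq₀ hle
    have hm : m < 0 := by
      by_contra! hm
      have := mul_nonneg hm (sub_pos.2 (hg s₁ hs₁ hne₁)).le
      linarith [hle s₁ hs₁]
    intro s hs hsa
    have := mul_neg_of_neg_of_pos hm (sub_pos.2 (hg s hs hsa))
    have := mul_neg_of_neg_of_pos hm (sub_pos.2 (hg s₀ hs₀ hne₀))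
    have := rigid ℓ m hle ⟨s₀, hs₀, by linarith, heq₀⟩ s hs
    linarith
  obtain ⟨b, hb, hadj⟩ := exists_polyAdj_of_collinear S ha g hg ⟨s₁, hs₁, hne₁⟩ fun φ => by
    obtain ⟨m, ⟨s₀, hs₀, hne₀, heq₀⟩, hle⟩ :=
      exists_tilt S (g : E →ₗ[ℝ] ℝ) (φ : E →ₗ[ℝ] ℝ) hg ⟨s₁, hs₁, hne₁⟩
    exact ⟨m, rigid φ m hle ⟨s₀, hs₀, hdown s₀ hs₀ hne₀, heq₀⟩⟩
  exact ⟨b, hadj, hdown b hb hadj.1.symm⟩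

theorem exists_path_to_face (ℓ : StrongDual ℝ E) (S : Finset E)
    (hint : ∀ s ∈ S, ∃ m : ℤ, ℓ s = m) (c : ℤ) (hc : ∀ s ∈ S, (c : ℝ) ≤ ℓ s)
    (hmin : ∃ s ∈ S, ℓ s = c) (n : ℕ) {a : E}
    (ha : a ∈ (convexHull ℝ (S : Set E)).extremePoints ℝ) (hn : ℓ a ≤ c + n) :
    ∃ L ≤ n, ∃ b ∈ (convexHull ℝ (S : Set E)).extremePoints ℝ, ℓ b = c ∧
      HasPathOfLength (convexHull ℝ (S : Set E)) a b L := by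
  induction n generalizing a with
  | zero =>
    have haS : a ∈ S := extremePoints_convexHull_subset ha
    exact ⟨0, le_rfl, a, ha, le_antisymm (by simpa using hn) (hc a haS), .refl _ a⟩
  | succ n ih =>
    have haS : a ∈ S := extremePoints_convexHull_subset ha
    rcases (hc a haS).eq_or_lt with hca | hca
    · exact ⟨0, Nat.zero_le _, a, ha, hca.symm, .refl _ a⟩
    obtain ⟨s, hs, hsc⟩ := hmin
    obtain ⟨a', hadj, hlt⟩ := exists_polyAdj_lt ℓ S ha ⟨s, hs, hsc ▸ hca⟩
    have hstep : ℓ a' ≤ c + n := by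
      obtain ⟨p, hp⟩ := hint a haS
      obtain ⟨q, hq⟩ := hint a' (extremePoints_convexHull_subset hadj.2.2.1)
      rw [hp, hq] at hlt
      rw [hp] at hn
      rw [hq]
      norm_cast at *
      push_cast at hn
      omega
    obtain ⟨L, hL, b, hb, hbc, hpath⟩ := ih hadj.2.2.1 hstep
    exact ⟨1 + L, by omega, b, hb, hbc, (HasPathOfLength.of_polyAdj hadj).trans hpath⟩

theorem exists_path_through_face (ℓ : StrongDual ℝ E) (S : Finset E)
    (hint : ∀ s ∈ S, ∃ m : ℤ, ℓ s = m) (c : ℤ) (hc : ∀ s ∈ S, (c : ℝ) ≤ ℓ s)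
    (hmin : ∃ s ∈ S, ℓ s = c) (D : ℕ)
    (hD : ∀ F ⊆ S, (∀ s ∈ F, ℓ s = c) →
      ∀ a ∈ (convexHull ℝ (F : Set E)).extremePoints ℝ,
      ∀ b ∈ (convexHull ℝ (F : Set E)).extremePoints ℝ,
        ∃ L ≤ D, HasPathOfLength (convexHull ℝ (F : Set E)) a b L)
    {a b : E} (ha : a ∈ (convexHull ℝ (S : Set E)).extremePoints ℝ)
    (hb : b ∈ (convexHull ℝ (S : Set E)).extremePoints ℝ) (n₁ n₂ : ℕ)
    (hn₁ : ℓ a ≤ c + n₁) (hn₂ : ℓ b ≤ c + n₂) :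
    ∃ L ≤ n₁ + n₂ + D, HasPathOfLength (convexHull ℝ (S : Set E)) a b L := by
  obtain ⟨L₁, hL₁, a', ha', hac, hpa⟩ := exists_path_to_face ℓ S hint c hc hmin n₁ ha hn₁
  obtain ⟨L₂, hL₂, b', hb', hbc, hpb⟩ := exists_path_to_face ℓ S hint c hc hmin n₂ hb hn₂
  have hface := isExtreme_convexHull_filter S (ℓ : E →ₗ[ℝ] ℝ) c hc
  have hmem : ∀ x ∈ (convexHull ℝ (S : Set E)).extremePoints ℝ, ℓ x = c →
      x ∈ (convexHull ℝ ((S.filter fun s => (ℓ : E →ₗ[ℝ] ℝ) s = c : Finset E) : Set E)).extremePoints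
        ℝ := fun x hx hxc =>
    inter_extremePoints_subset_extremePoints_of_subset hface.subset
      ⟨subset_convexHull ℝ _ (Finset.mem_coe.2 (Finset.mem_filter.2
        ⟨extremePoints_convexHull_subset hx, hxc⟩)), hx⟩
  obtain ⟨L, hL, hp⟩ := hD _ (Finset.filter_subset _ _) (fun s hs => (Finset.mem_filter.1 hs).2)
    a' (hmem a' ha' hac) b' (hmem b' hb' hbc)
  exact ⟨L₁ + L + L₂, by omega, (hpa.trans (hp.of_isExtreme hface)).trans hpb.symm⟩

end Edges

/-- The diameter bound for lattice polytopes that are constant in the coordinates outside `T`. -/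
theorem exists_path_of_constant_off {ι : Type*} [Fintype ι] (k : ℕ) (T : Finset ι)
    (S : Finset (ι → ℝ)) (hlat : ∀ x ∈ S, ∀ i, ∃ m : ℕ, m ≤ k ∧ x i = (m : ℝ))
    (hT : ∀ i ∉ T, ∀ x ∈ S, ∀ y ∈ S, x i = y i) :
    ∀ a ∈ (convexHull ℝ (S : Set (ι → ℝ))).extremePoints ℝ,
      ∀ b ∈ (convexHull ℝ (S : Set (ι → ℝ))).extremePoints ℝ,
        ∃ L ≤ k * T.card, HasPathOfLength (convexHull ℝ (S : Set (ι → ℝ))) a b L := by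
  classical
  induction T using Finset.induction_on generalizing S with
  | empty =>
    intro a ha b hb
    obtain rfl : a = b := funext fun i => hT i (Finset.notMem_empty i)
      a (extremePoints_convexHull_subset ha) b (extremePoints_convexHull_subset hb)
    exact ⟨0, Nat.zero_le _, .refl _ a⟩
  | insert j T hj ih =>
    intro a ha b hb
    have haS : a ∈ S := extremePoints_convexHull_subset ha
    have hbS : b ∈ S := extremePoints_convexHull_subset hb
    have hD : ∀ v : ℝ, ∀ F ⊆ S, (∀ s ∈ F, s j = v) →
        ∀ a ∈ (convexHull ℝ (F : Set (ι → ℝ))).extremePoints ℝ,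
        ∀ b ∈ (convexHull ℝ (F : Set (ι → ℝ))).extremePoints ℝ,
          ∃ L ≤ k * T.card, HasPathOfLength (convexHull ℝ (F : Set (ι → ℝ))) a b L := by
      intro v F hFS hF
      refine ih F (fun x hx => hlat x (hFS hx)) fun i hi x hx y hy => ?_
      by_cases hij : i = j
      · rw [hij, hF x hx, hF y hy]
      · exact hT i (by simp [hij, hi]) x (hFS hx) y (hFS hy)
    obtain ⟨p, hp, hpmin⟩ := S.exists_min_image (fun s => s j) ⟨a, haS⟩
    obtain ⟨q, hq, hqmax⟩ := S.exists_max_image (fun s => s j) ⟨a, haS⟩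
    obtain ⟨mp, -, hmp⟩ := hlat p hp j
    obtain ⟨mq, hmqk, hmq⟩ := hlat q hq j
    obtain ⟨ma, -, hma⟩ := hlat a haS j
    obtain ⟨mb, -, hmb⟩ := hlat b hbS j
    have hpa : mp ≤ ma := by
      have := hpmin a haS
      rw [hmp, hma] at this
      exact_mod_cast this
    have hpb : mp ≤ mb := by
      have := hpmin b hbS
      rw [hmp, hmb] at this
      exact_mod_cast this
    have haq : ma ≤ mq := by
      have := hqmax a haS
      rw [hmq, hma] at this
      exact_mod_cast this
    have hbq : mb ≤ mq := by
      have := hqmax b hbS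
      rw [hmq, hmb] at this
      exact_mod_cast this
    rw [Finset.card_insert_of_notMem hj, mul_add, mul_one]
    by_cases hk : (ma - mp) + (mb - mp) ≤ k
    · obtain ⟨L, hL, hpath⟩ := exists_path_through_face
        (ContinuousLinearMap.proj j : StrongDual ℝ (ι → ℝ)) S
        (fun s hs => by
          obtain ⟨m, -, hm⟩ := hlat s hs j
          exact ⟨m, by simpa using hm⟩)
        mp (fun s hs => by simpa [hmp] using hpmin s hs) ⟨p, hp, by simpa using hmp⟩
        (k * T.card) (fun F hFS hF => hD mp F hFS fun s hs => by simpa using hF s hs)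
        ha hb (ma - mp) (mb - mp)
        (by simp [hma, Nat.cast_sub hpa]) (by simp [hmb, Nat.cast_sub hpb])
      exact ⟨L, by omega, hpath⟩
    · obtain ⟨L, hL, hpath⟩ := exists_path_through_face
        (-ContinuousLinearMap.proj j : StrongDual ℝ (ι → ℝ)) S
        (fun s hs => by
          obtain ⟨m, -, hm⟩ := hlat s hs j
          exact ⟨-m, by simpa using hm⟩)
        (-mq) (fun s hs => by simpa [hmq] using hqmax s hs) ⟨q, hq, by simpa using hmq⟩
        (k * T.card) (fun F hFS hF => hD mq F hFS fun s hs => by simpa using hF s hs)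
        ha hb (mq - ma) (mq - mb)
        (by simp [hma, Nat.cast_sub haq]) (by simp [hmb, Nat.cast_sub hbq])
      exact ⟨L, by omega, hpath⟩

/-- (Kleinschmidt–Onn) The diameter of a lattice polytope contained in `[0,k]^d` is at most
`k · d`. -/
theorem kleinschmidt_onn
    (d k : ℕ) (hk : 1 ≤ k) (S : Finset (Fin d → ℝ)) (hS : S.Nonempty)
    (hlat : ∀ x ∈ S, ∀ i, ∃ m : ℕ, m ≤ k ∧ x i = (m : ℝ)) :
    ∀ a ∈ Set.extremePoints ℝ (convexHull ℝ (S : Set (Fin d → ℝ))),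
      ∀ b ∈ Set.extremePoints ℝ (convexHull ℝ (S : Set (Fin d → ℝ))),
        ∃ L ≤ k * d, HasPathOfLength (convexHull ℝ (S : Set (Fin d → ℝ))) a b L := by
  simpa using exists_path_of_constant_off k Finset.univ S hlat
    fun i hi => absurd (Finset.mem_univ i) hi
end
end

section
/- (Klee–Walkup, d-step implies Hirsch) Suppose that for every d ≥ 2 and every polytope Q ⊆ (Fin d → ℝ) of dimension d with exactly 2d facets, any two extreme points of Q are joined by a path in G(Q) of length at most d. Then for all integers n > d ≥ 2 and every polytope P ⊆ (Fin d → ℝ) of dimension d with exactly n facets, any two extreme points of P are joined by a path in G(P) of length at most n − d. -/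
open scoped BigOperators

noncomputable section

/-- A face of a convex set `P`: a convex extreme subset. -/
def IsFace {E : Type*} [AddCommGroup E] [Module ℝ E] (P F : Set E) : Prop :=
  Convex ℝ F ∧ IsExtreme ℝ P F

/-- The dimension of a set: the rank of the direction of its affine span. -/
noncomputable def setDim {E : Type*} [AddCommGroup E] [Module ℝ E] (S : Set E) : ℕ :=
  Module.finrank ℝ (affineSpan ℝ S).direction

/-- A facet of `P` is a face of dimension `dim P - 1`. -/
def IsFacet {E : Type*} [AddCommGroup E] [Module ℝ E] (P F : Set E) : Prop :=
  IsFace P F ∧ setDim F = setDim P - 1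

/-- The number of facets of `P`. -/
noncomputable def numFacets {E : Type*} [AddCommGroup E] [Module ℝ E] (P : Set E) : ℕ :=
  Set.ncard {F : Set E | IsFacet P F}

/-- The polyhedron cut out by the inequalities `0 ≤ g i x`. -/
def polyhedron {E ι : Type*} [AddCommGroup E] [Module ℝ E] (g : ι → E →ᵃ[ℝ] ℝ) : Set E :=
  {x | ∀ i, 0 ≤ g i x}

/-- Every linear functional is bounded above on `P`. -/
def LinearlyBounded {E : Type*} [AddCommGroup E] [Module ℝ E] (P : Set E) : Prop :=
  ∀ l : E →ₗ[ℝ] ℝ, ∃ C, ∀ x ∈ P, l x ≤ C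

/-- Any two extreme points of `P` are joined by a path of length at most `m`. -/
def DiamLE {E : Type*} [AddCommGroup E] [Module ℝ E] (P : Set E) (m : ℕ) : Prop :=
  ∀ a ∈ Set.extremePoints ℝ P, ∀ b ∈ Set.extremePoints ℝ P, ∃ L ≤ m, HasPathOfLength P a b L

/-- No inequality of the system `g` follows from the others. -/
def Irredundant {E ι : Type*} [AddCommGroup E] [Module ℝ E] (g : ι → E →ᵃ[ℝ] ℝ) : Prop :=
  ∀ i, ∃ y, g i y < 0 ∧ ∀ j, j ≠ i → 0 ≤ g j y

section Polyhedron

variable {E F ι : Type*} [AddCommGroup E] [Module ℝ E] [AddCommGroup F] [Module ℝ F]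

lemma affineMap_add_smul (f : E →ᵃ[ℝ] ℝ) (z v : E) (t : ℝ) :
    f (z + t • v) = f z + t * f.linear v := by
  have := f.map_vadd z (t • v)
  simp only [vadd_eq_add, map_smul, smul_eq_mul] at this
  rw [add_comm z, this, add_comm]

lemma affineMap_sub (f : E →ᵃ[ℝ] ℝ) (x y : E) : f.linear (x - y) = f x - f y := by
  simpa using f.linearMap_vsub x y

lemma affineMap_combo (f : E →ᵃ[ℝ] F) (x y : E) {a b : ℝ} (h : a + b = 1) :
    f (a • x + b • y) = a • f x + b • f y :=
  Convex.combo_affine_apply h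

lemma convex_polyhedron (g : ι → E →ᵃ[ℝ] ℝ) : Convex ℝ (polyhedron g) := by
  intro x hx y hy a b ha hb hab i
  rw [affineMap_combo _ _ _ hab]
  have := hx i
  have := hy i
  simp only [smul_eq_mul]
  positivity

lemma midpoint_pos_of_forall_ne_zero (g : ι → E →ᵃ[ℝ] ℝ) {u v : E}
    (hu : u ∈ polyhedron g) (hv : v ∈ polyhedron g) (h : ∀ i, g i u = 0 → g i v ≠ 0) (i : ι) :
    0 < g i ((1 / 2 : ℝ) • u + (1 / 2 : ℝ) • v) := by
  rw [affineMap_combo _ _ _ (by norm_num)]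
  simp only [smul_eq_mul]
  rcases (hu i).lt_or_eq with hi | hi
  · linarith [hv i]
  · have := (hv i).lt_of_ne (h i hi.symm).symm
    linarith

lemma exists_forall_add_smul_mem_polyhedron [Finite ι] (g : ι → E →ᵃ[ℝ] ℝ) (z v : E)
    (h : ∀ i, 0 < g i z ∨ (g i z = 0 ∧ (g i).linear v = 0)) :
    ∃ ε > 0, ∀ t : ℝ, |t| ≤ ε → z + t • v ∈ polyhedron g := by
  have key : ∀ᶠ t : ℝ in nhds 0, ∀ i, 0 ≤ g i (z + t • v) := by
    rw [Filter.eventually_all]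
    intro i
    simp only [affineMap_add_smul]
    rcases h i with h | ⟨h, h'⟩
    · have hc : ContinuousAt (fun t : ℝ => g i z + t * (g i).linear v) 0 := by fun_prop
      have := hc.eventually (lt_mem_nhds (a := 0) (by simpa using h))
      filter_upwards [this] with t ht using ht.le
    · simp [h, h']
  obtain ⟨ε, hε, h⟩ := Metric.eventually_nhds_iff.1 key
  refine ⟨ε / 2, by positivity, fun t ht => h ?_⟩
  rw [Real.dist_eq, sub_zero]
  linarith

lemma eq_zero_of_mem_extremePoints_polyhedron [Finite ι] (g : ι → E →ᵃ[ℝ] ℝ) {u v : E}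
    (hu : u ∈ Set.extremePoints ℝ (polyhedron g))
    (hv : ∀ i, g i u = 0 → (g i).linear v = 0) : v = 0 := by
  obtain ⟨ε, hε, h⟩ := exists_forall_add_smul_mem_polyhedron g u v fun i => by
    rcases (hu.1 i).lt_or_eq with h | h
    · exact .inl h
    · exact .inr ⟨h.symm, hv i h.symm⟩
  have h1 := h ε (by rw [abs_of_pos hε])
  have h2 := h (-ε) (by rw [abs_neg, abs_of_pos hε])
  have := hu.2 h1 h2 ⟨1 / 2, 1 / 2, by norm_num, by norm_num, by norm_num, by module⟩
  rw [add_eq_left, smul_eq_zero] at this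
  exact this.resolve_left hε.ne'

open Classical in
lemma card_nonzero_add_finrank_le [Fintype ι] [FiniteDimensional ℝ E] (g : ι → E →ᵃ[ℝ] ℝ) {u : E}
    (hu : u ∈ Set.extremePoints ℝ (polyhedron g)) :
    (Finset.univ.filter fun i => g i u ≠ 0).card + Module.finrank ℝ E ≤ Fintype.card ι := by
  let T : E →ₗ[ℝ] ({i // g i u = 0} → ℝ) := LinearMap.pi fun i => (g i).linear
  have hT : Function.Injective T := by
    rw [← LinearMap.ker_eq_bot, LinearMap.ker_eq_bot']
    intro v hv
    exact eq_zero_of_mem_extremePoints_polyhedron g hu fun i hi => congrFun hv ⟨i, hi⟩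
  have h1 := LinearMap.finrank_le_finrank_of_injective hT
  rw [Module.finrank_fintype_fun_eq_card, Fintype.card_subtype] at h1
  have h2 := Finset.card_filter_add_card_filter_not (s := (Finset.univ : Finset ι))
    (fun i => g i u = 0)
  rw [Finset.card_univ] at h2
  simp only [ne_eq]
  omega

lemma DiamLE.mono {P : Set E} {m n : ℕ} (h : DiamLE P m) (hmn : m ≤ n) : DiamLE P n := by
  intro a ha b hb
  obtain ⟨L, hL, hp⟩ := h a ha b hb
  exact ⟨L, hL.trans hmn, hp⟩

lemma HasPathOfLength.append {P : Set E} {a b c : E} {L : ℕ} (h : HasPathOfLength P a b L)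
    (hbc : PolyAdj P b c) : HasPathOfLength P a c (L + 1) := by
  obtain ⟨f, h0, hL, hf⟩ := h
  refine ⟨fun i => if i ≤ L then f i else c, by simpa using h0, by simp, fun i hi => ?_⟩
  rcases Nat.lt_succ_iff_lt_or_eq.1 hi with h | rfl
  · simpa [h.le, Nat.succ_le_of_lt h] using hf i h
  · simpa [hL] using hbc

/-- An affine map sending faces of `P` to faces of `Q` maps paths to paths that are no longer. -/
lemma HasPathOfLength.map {P : Set E} {Q : Set F} (T : E →ᵃ[ℝ] F)
    (hT : ∀ B, IsExtreme ℝ P B → IsExtreme ℝ Q (T '' B)) {a b : E} {L : ℕ}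
    (h : HasPathOfLength P a b L) : ∃ L' ≤ L, HasPathOfLength Q (T a) (T b) L' := by
  have hpt : ∀ x ∈ Set.extremePoints ℝ P, T x ∈ Set.extremePoints ℝ Q := by
    intro x hx
    rw [← isExtreme_singleton] at hx ⊢
    simpa using hT _ hx
  obtain ⟨f, rfl, rfl, hf⟩ := h
  induction L with
  | zero => exact ⟨0, le_rfl, fun _ => T (f 0), rfl, rfl, by simp⟩
  | succ L ih =>
    obtain ⟨L', hL', hp⟩ := ih fun i hi => hf i (by omega)
    obtain ⟨-, h1, h2, h3⟩ := hf L (by omega)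
    by_cases he : T (f L) = T (f (L + 1))
    · exact ⟨L', by omega, he ▸ hp⟩
    · refine ⟨L' + 1, by omega, hp.append ⟨he, hpt _ h1, hpt _ h2, ?_⟩⟩
      have := hT _ h3
      rwa [image_segment] at this

lemma isExtreme_image_of_injective {P : Set E} {Q : Set F} (T : E →ᵃ[ℝ] F)
    (hT : Function.Injective T) (hPQ : IsExtreme ℝ Q (T '' P)) {B : Set E}
    (hB : IsExtreme ℝ P B) : IsExtreme ℝ Q (T '' B) := by
  refine hPQ.trans ⟨Set.image_mono hB.1, ?_⟩
  rintro _ ⟨x, hx, rfl⟩ _ ⟨y, hy, rfl⟩ _ ⟨z, hz, rfl⟩ hzxy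
  rw [← image_openSegment] at hzxy
  obtain ⟨w, hw, hwz⟩ := hzxy
  exact ⟨x, hB.2 hx hy hz (hT hwz ▸ hw), rfl⟩

lemma mem_extremePoints_of_map_mem {P : Set E} {Q : Set F} (T : E →ᵃ[ℝ] F)
    (hT : Function.Injective T) (hPQ : T '' P ⊆ Q) {a : E} (ha : a ∈ P)
    (hTa : T a ∈ Set.extremePoints ℝ Q) : a ∈ Set.extremePoints ℝ P := by
  refine ⟨ha, fun x hx y hy hxy => hT ?_⟩
  refine hTa.2 (hPQ ⟨x, hx, rfl⟩) (hPQ ⟨y, hy, rfl⟩) ?_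
  rw [← image_openSegment]
  exact ⟨a, hxy, rfl⟩

lemma isExtreme_zero_polyhedron (g : ι → E →ᵃ[ℝ] ℝ) (i : ι) :
    IsExtreme ℝ (polyhedron g) {x ∈ polyhedron g | g i x = 0} := by
  refine ⟨fun x hx => hx.1, ?_⟩
  rintro x hx y hy z ⟨hz, hz0⟩ ⟨a, b, ha, hb, hab, rfl⟩
  refine ⟨hx, ?_⟩
  rw [affineMap_combo _ _ _ hab] at hz0
  simp only [smul_eq_mul] at hz0
  nlinarith [hx i, hy i, mul_nonneg ha.le (hx i), mul_nonneg hb.le (hy i)]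

end Polyhedron

section Reductions

variable {E ι : Type*} [AddCommGroup E] [Module ℝ E]

open Classical in
/-- The inequalities of the wedge `{(x, t) | x ∈ P, 0 ≤ t ≤ g i x}` over `P = polyhedron g`. -/
def wedge (g : ι → E →ᵃ[ℝ] ℝ) (i : ι) : Option ι → (E × ℝ) →ᵃ[ℝ] ℝ
  | none => (LinearMap.snd ℝ E ℝ).toAffineMap
  | some j => (g j).comp (LinearMap.fst ℝ E ℝ).toAffineMap -
      if j = i then (LinearMap.snd ℝ E ℝ).toAffineMap else 0

lemma mem_wedge (g : ι → E →ᵃ[ℝ] ℝ) (i : ι) (p : E × ℝ) :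
    p ∈ polyhedron (wedge g i) ↔ p.1 ∈ polyhedron g ∧ 0 ≤ p.2 ∧ p.2 ≤ g i p.1 := by
  constructor
  · intro h
    have h0 : 0 ≤ p.2 := by simpa [wedge] using h none
    have hi : p.2 ≤ g i p.1 := by simpa [wedge] using h (some i)
    refine ⟨fun j => ?_, h0, hi⟩
    by_cases hj : j = i
    · exact hj ▸ h0.trans hi
    · simpa [wedge, hj] using h (some j)
  · rintro ⟨h1, h2, h3⟩ (_ | j)
    · simpa [wedge] using h2
    · by_cases hj : j = i
      · subst hj
        simpa [wedge] using h3
      · simpa [wedge, hj] using h1 j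

lemma wedge_pos (g : ι → E →ᵃ[ℝ] ℝ) (i : ι) {z : E} (hz : ∀ j, 0 < g j z) (j : Option ι) :
    0 < wedge g i j (z, g i z / 2) := by
  rcases j with _ | j
  · simpa [wedge] using hz i
  · by_cases hj : j = i
    · subst hj
      simpa [wedge] using hz j
    · simpa [wedge, hj] using hz j

lemma LinearlyBounded.exists_affine_le {P : Set E} (hP : LinearlyBounded P) (f : E →ᵃ[ℝ] ℝ) :
    ∃ C, ∀ x ∈ P, f x ≤ C := by
  obtain ⟨C, hC⟩ := hP f.linear
  refine ⟨C + f 0, fun x hx => ?_⟩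
  have := hC x hx
  have h2 := affineMap_sub f x 0
  rw [sub_zero] at h2
  linarith

lemma LinearlyBounded.wedge {g : ι → E →ᵃ[ℝ] ℝ} (hP : LinearlyBounded (polyhedron g)) (i : ι) :
    LinearlyBounded (polyhedron (wedge g i)) := by
  intro l
  obtain ⟨C, hC⟩ := hP (l.comp (LinearMap.inl ℝ E ℝ))
  obtain ⟨D, hD⟩ := hP.exists_affine_le (g i)
  refine ⟨C + D * |l (0, 1)|, ?_⟩
  rintro ⟨x, t⟩ h
  obtain ⟨h1, h2, h3⟩ := (mem_wedge g i _).1 h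
  have e : l (x, t) = l (x, 0) + t * l (0, 1) := by
    rw [← smul_eq_mul, ← map_smul, ← map_add]
    simp
  have h4 : l (x, 0) ≤ C := hC x h1
  have h5 : t * l (0, 1) ≤ D * |l (0, 1)| :=
    (mul_le_mul_of_nonneg_left (le_abs_self _) h2).trans
      (mul_le_mul_of_nonneg_right (h3.trans (hD x h1)) (abs_nonneg _))
  rw [e]
  exact add_le_add h4 h5

lemma isExtreme_fst_image_wedge (g : ι → E →ᵃ[ℝ] ℝ) (i : ι) (B : Set (E × ℝ))
    (hB : IsExtreme ℝ (polyhedron (wedge g i)) B) :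
    IsExtreme ℝ (polyhedron g) ((LinearMap.fst ℝ E ℝ).toAffineMap '' B) := by
  refine ⟨?_, ?_⟩
  · rintro _ ⟨p, hp, rfl⟩
    exact ((mem_wedge g i p).1 (hB.1 hp)).1
  · rintro x hx y hy _ ⟨⟨z, r⟩, hz, rfl⟩ ⟨a, b, ha, hb, hab, hxy⟩
    obtain ⟨-, h2, h3⟩ := (mem_wedge g i _).1 (hB.1 hz)
    simp only [LinearMap.coe_toAffineMap, LinearMap.fst_apply] at hxy h2 h3
    subst hxy
    obtain ⟨θ, h0, h1, hθ⟩ : ∃ θ : ℝ, 0 ≤ θ ∧ θ ≤ 1 ∧ θ * g i (a • x + b • y) = r := by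
      rcases (h2.trans h3).lt_or_eq with h | h
      · exact ⟨r / g i (a • x + b • y), by positivity, (div_le_one h).2 h3,
          div_mul_cancel₀ _ h.ne'⟩
      · exact ⟨0, le_rfl, zero_le_one, by linarith⟩
    have hmem : ∀ w ∈ polyhedron g, (w, θ * g i w) ∈ polyhedron (wedge g i) := fun w hw =>
      (mem_wedge g i _).2 ⟨hw, mul_nonneg h0 (hw i), mul_le_of_le_one_left (hw i) h1⟩
    refine ⟨_, hB.2 (hmem x hx) (hmem y hy) hz ⟨a, b, ha, hb, hab, ?_⟩, rfl⟩
    rw [affineMap_combo _ _ _ hab] at hθ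
    simp only [smul_eq_mul] at hθ
    ext
    · simp
    · simp only [Prod.smul_mk, Prod.mk_add_mk, smul_eq_mul]
      linarith

lemma mem_extremePoints_wedge (g : ι → E →ᵃ[ℝ] ℝ) (i : ι) {a : E}
    (ha : a ∈ Set.extremePoints ℝ (polyhedron g)) :
    (a, (0 : ℝ)) ∈ Set.extremePoints ℝ (polyhedron (wedge g i)) := by
  refine ⟨(mem_wedge g i _).2 ⟨ha.1, le_rfl, ha.1 i⟩, ?_⟩
  rintro ⟨x, s⟩ hx ⟨y, t⟩ hy ⟨c, d, hc, hd, hcd, h⟩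
  obtain ⟨hx1, hx2, -⟩ := (mem_wedge g i _).1 hx
  obtain ⟨hy1, hy2, -⟩ := (mem_wedge g i _).1 hy
  simp only [Prod.smul_mk, Prod.mk_add_mk, smul_eq_mul, Prod.mk.injEq] at h hx1 hx2 hy1 hy2 ⊢
  refine ⟨ha.2 hx1 hy1 ⟨c, d, hc, hd, hcd, h.1⟩, ?_⟩
  nlinarith [mul_nonneg hc.le hx2, mul_nonneg hd.le hy2]

lemma diamLE_of_wedge {g : ι → E →ᵃ[ℝ] ℝ} (i : ι) {m : ℕ}
    (h : DiamLE (polyhedron (wedge g i)) m) : DiamLE (polyhedron g) m := by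
  intro a ha b hb
  obtain ⟨L, hL, hp⟩ := h _ (mem_extremePoints_wedge g i ha) _ (mem_extremePoints_wedge g i hb)
  obtain ⟨L', hL', hp'⟩ := hp.map _ (isExtreme_fst_image_wedge g i)
  exact ⟨L', hL'.trans hL, hp'⟩

/-- The parametrization of the hyperplane through `u` parallel to `ker f.linear`. -/
def hyperplaneMap (f : E →ᵃ[ℝ] ℝ) (u : E) : LinearMap.ker f.linear →ᵃ[ℝ] E :=
  (LinearMap.ker f.linear).subtype.toAffineMap + AffineMap.const ℝ _ u

lemma hyperplaneMap_apply (f : E →ᵃ[ℝ] ℝ) (u : E) (y : LinearMap.ker f.linear) :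
    hyperplaneMap f u y = y + u := rfl

lemma finrank_le_finrank_ker_add_one [FiniteDimensional ℝ E] (f : E →ₗ[ℝ] ℝ) :
    Module.finrank ℝ E ≤ Module.finrank ℝ (LinearMap.ker f) + 1 := by
  have h1 := LinearMap.finrank_range_add_finrank_ker f
  have h2 := (LinearMap.range f).finrank_le
  rw [Module.finrank_self] at h2
  omega

/-- The inequalities of the face `g i = 0`, in the coordinates of the hyperplane through `u`. -/
def faceSystem (g : ι → E →ᵃ[ℝ] ℝ) (i : ι) (u : E) :
    {j // j ≠ i} → LinearMap.ker (g i).linear →ᵃ[ℝ] ℝ :=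
  fun j => (g j).comp (hyperplaneMap (g i) u)

lemma image_faceSystem (g : ι → E →ᵃ[ℝ] ℝ) (i : ι) {u : E} (hu : g i u = 0) :
    hyperplaneMap (g i) u '' polyhedron (faceSystem g i u) = {x ∈ polyhedron g | g i x = 0} := by
  ext x
  constructor
  · rintro ⟨y, hy, rfl⟩
    have h0 : g i (hyperplaneMap (g i) u y) = 0 := by
      have h1 := affineMap_sub (g i) (y + u) u
      rw [add_sub_cancel_right, hu, sub_zero] at h1
      rw [hyperplaneMap_apply, ← h1]
      exact y.2
    refine ⟨fun j => ?_, h0⟩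
    by_cases hj : j = i
    · exact hj ▸ h0.ge
    · exact hy ⟨j, hj⟩
  · rintro ⟨hx, hx0⟩
    have hk : x - u ∈ LinearMap.ker (g i).linear := by
      rw [LinearMap.mem_ker, affineMap_sub, hx0, hu, sub_zero]
    have hT : hyperplaneMap (g i) u ⟨x - u, hk⟩ = x := by simp [hyperplaneMap_apply]
    refine ⟨⟨x - u, hk⟩, fun j => ?_, hT⟩
    simp only [faceSystem, AffineMap.comp_apply, hT]
    exact hx j

lemma linearlyBounded_faceSystem {g : ι → E →ᵃ[ℝ] ℝ} (hP : LinearlyBounded (polyhedron g))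
    (i : ι) {u : E} (hu : g i u = 0) : LinearlyBounded (polyhedron (faceSystem g i u)) := by
  intro l
  obtain ⟨l', hl'⟩ := l.exists_extend
  obtain ⟨C, hC⟩ := hP l'
  refine ⟨C - l' u, fun y hy => ?_⟩
  have h1 := hC _ ((image_faceSystem g i hu).le ⟨y, hy, rfl⟩).1
  have h2 : l' y = l y := LinearMap.congr_fun hl' y
  rw [hyperplaneMap_apply, map_add, h2] at h1
  linarith

lemma exists_path_of_faceSystem {g : ι → E →ᵃ[ℝ] ℝ} (i : ι) {u v : E} {m : ℕ}
    (hu : u ∈ Set.extremePoints ℝ (polyhedron g)) (hv : v ∈ Set.extremePoints ℝ (polyhedron g))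
    (hui : g i u = 0) (hvi : g i v = 0) (h : DiamLE (polyhedron (faceSystem g i u)) m) :
    ∃ L ≤ m, HasPathOfLength (polyhedron g) u v L := by
  have him := image_faceSystem g i hui
  have hinj : Function.Injective (hyperplaneMap (g i) u) := by
    intro x y hxy
    simpa [hyperplaneMap_apply] using hxy
  have hext := isExtreme_zero_polyhedron g i
  rw [← him] at hext
  obtain ⟨a, ha, hau⟩ := him.ge ⟨hu.1, hui⟩
  obtain ⟨b, hb, hbv⟩ := him.ge ⟨hv.1, hvi⟩
  obtain ⟨L, hL, hp⟩ := h a (mem_extremePoints_of_map_mem _ hinj hext.1 ha (by rwa [hau]))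
    b (mem_extremePoints_of_map_mem _ hinj hext.1 hb (by rwa [hbv]))
  obtain ⟨L', hL', hp'⟩ := hp.map _ fun B => isExtreme_image_of_injective _ hinj hext
  rw [hau, hbv] at hp'
  exact ⟨L', hL'.trans hL, hp'⟩

end Reductions

section Facets

variable {E ι : Type*} [AddCommGroup E] [Module ℝ E]

lemma vectorSpan_eq_of_forall_exists_add_smul_mem {B : Set E} {K : Submodule ℝ E} {w : E}
    (hw : w ∈ B) (hBK : ∀ x ∈ B, x - w ∈ K) (hK : ∀ v ∈ K, ∃ ε > (0 : ℝ), w + ε • v ∈ B) :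
    vectorSpan ℝ B = K := by
  apply le_antisymm
  · rw [vectorSpan_def, Submodule.span_le]
    rintro _ ⟨x, hx, y, hy, rfl⟩
    have := K.sub_mem (hBK x hx) (hBK y hy)
    rwa [sub_sub_sub_cancel_right] at this
  · intro v hv
    obtain ⟨ε, hε, h⟩ := hK v hv
    have h1 := vsub_mem_vectorSpan ℝ h hw
    rw [vsub_eq_sub, add_sub_cancel_left] at h1
    exact (Submodule.smul_mem_iff _ hε.ne').1 h1

lemma setDim_eq_of_vectorSpan_eq {B : Set E} {K : Submodule ℝ E} (h : vectorSpan ℝ B = K) :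
    setDim B = Module.finrank ℝ K := by
  rw [setDim, direction_affineSpan, h]

lemma setDim_polyhedron [Finite ι] (g : ι → E →ᵃ[ℝ] ℝ) {z : E} (hz : ∀ i, 0 < g i z) :
    setDim (polyhedron g) = Module.finrank ℝ E := by
  rw [setDim_eq_of_vectorSpan_eq (K := ⊤), finrank_top]
  refine vectorSpan_eq_of_forall_exists_add_smul_mem (w := z) (fun i => (hz i).le) (fun _ _ => trivial) ?_
  intro v _
  obtain ⟨ε, hε, h⟩ := exists_forall_add_smul_mem_polyhedron g z v fun i => .inl (hz i)
  exact ⟨ε, hε, h ε (abs_of_pos hε).le⟩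

lemma Irredundant.exists_mem_facet {g : ι → E →ᵃ[ℝ] ℝ} (hg : Irredundant g) {z : E}
    (hz : ∀ i, 0 < g i z) (i : ι) :
    ∃ w, g i w = 0 ∧ ∀ j, j ≠ i → 0 < g j w := by
  obtain ⟨y, hy, hyj⟩ := hg i
  have hi := hz i
  have hs : 0 < g i z - g i y := by linarith
  have hab : -g i y / (g i z - g i y) + g i z / (g i z - g i y) = 1 := by
    field_simp
    ring
  refine ⟨(-g i y / (g i z - g i y)) • z + (g i z / (g i z - g i y)) • y, ?_, fun j hj => ?_⟩
  · rw [affineMap_combo _ _ _ hab]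
    simp only [smul_eq_mul]
    field_simp
    ring
  · rw [affineMap_combo _ _ _ hab]
    simp only [smul_eq_mul]
    have h1 : 0 < -g i y / (g i z - g i y) := div_pos (by linarith) hs
    have h2 : 0 < g i z / (g i z - g i y) := div_pos hi hs
    have h3 := mul_pos h1 (hz j)
    have h4 := mul_nonneg h2.le (hyj j hj)
    linarith

lemma Irredundant.setDim_facet [Finite ι] [FiniteDimensional ℝ E] {g : ι → E →ᵃ[ℝ] ℝ}
    (hg : Irredundant g) {z : E} (hz : ∀ i, 0 < g i z) (i : ι) :
    setDim {x ∈ polyhedron g | g i x = 0} = Module.finrank ℝ E - 1 := by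
  obtain ⟨w, hw, hwj⟩ := hg.exists_mem_facet hz i
  have hwP : w ∈ polyhedron g := fun j => by
    by_cases hj : j = i
    · exact hj ▸ hw.ge
    · exact (hwj j hj).le
  rw [setDim_eq_of_vectorSpan_eq (K := LinearMap.ker (g i).linear)]
  · have hne : (g i).linear ≠ 0 := by
      intro h
      have h1 := affineMap_sub (g i) z w
      rw [h, hw, LinearMap.zero_apply, sub_zero] at h1
      exact (hz i).ne h1
    have := Module.Dual.finrank_ker_add_one_of_ne_zero (f := (g i).linear) hne
    omega
  · refine vectorSpan_eq_of_forall_exists_add_smul_mem ⟨hwP, hw⟩ ?_ ?_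
    · rintro x ⟨-, hx⟩
      rw [LinearMap.mem_ker, affineMap_sub, hx, hw, sub_zero]
    · intro v hv
      rw [LinearMap.mem_ker] at hv
      obtain ⟨ε, hε, h⟩ := exists_forall_add_smul_mem_polyhedron g w v fun j => by
        by_cases hj : j = i
        · subst hj
          exact .inr ⟨hw, hv⟩
        · exact .inl (hwj j hj)
      refine ⟨ε, hε, h ε (abs_of_pos hε).le, ?_⟩
      rw [affineMap_add_smul, hw, hv, mul_zero, add_zero]

lemma mem_of_isExtreme_polyhedron [Finite ι] {g : ι → E →ᵃ[ℝ] ℝ} {B : Set E}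
    (hB : IsExtreme ℝ (polyhedron g) B) {w x : E} (hw : w ∈ B) (hx : x ∈ polyhedron g)
    (h : ∀ j, g j w = 0 → g j x = 0) : x ∈ B := by
  obtain ⟨ε, hε, hmem⟩ := exists_forall_add_smul_mem_polyhedron g w (w - x) fun j => by
    rcases (hB.1 hw j).lt_or_eq with hj | hj
    · exact .inl hj
    · exact .inr ⟨hj.symm, by rw [affineMap_sub, ← hj, h j hj.symm, sub_zero]⟩
  refine hB.2 hx (hmem ε (abs_of_pos hε).le) hw
    ⟨ε / (1 + ε), 1 / (1 + ε), by positivity, by positivity, by field_simp; ring, ?_⟩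
  match_scalars <;> field_simp
  ring

lemma exists_relint_point [Finite ι] {g : ι → E →ᵃ[ℝ] ℝ} {B : Set E} (hB : Convex ℝ B)
    (hBg : B ⊆ polyhedron g) (hne : B.Nonempty) :
    ∃ w ∈ B, ∀ j, g j w = 0 → ∀ x ∈ B, g j x = 0 := by
  classical
  have := Fintype.ofFinite ι
  suffices ∀ s : Finset ι, ∃ w ∈ B, ∀ j ∈ s, g j w = 0 → ∀ x ∈ B, g j x = 0 by
    simpa using this Finset.univ
  intro s
  induction s using Finset.induction_on with
  | empty => exact ⟨hne.some, hne.some_mem, by simp⟩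
  | insert j s _ ih =>
    obtain ⟨w, hw, hws⟩ := ih
    by_cases hj : ∀ x ∈ B, g j x = 0
    · refine ⟨w, hw, fun k hk => ?_⟩
      rcases Finset.mem_insert.1 hk with rfl | hk
      · exact fun _ => hj
      · exact hws k hk
    · push Not at hj
      obtain ⟨y, hy, hyj⟩ := hj
      refine ⟨(1 / 2 : ℝ) • w + (1 / 2 : ℝ) • y,
        hB hw hy (by norm_num) (by norm_num) (by norm_num), fun k hk h0 => ?_⟩
      rw [affineMap_combo _ _ _ (by norm_num)] at h0
      simp only [smul_eq_mul] at h0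
      have h1 := hBg hw k
      have h2 := hBg hy k
      rcases Finset.mem_insert.1 hk with rfl | hk
      · exact absurd (by linarith) hyj
      · exact hws k hk (by linarith)

lemma eq_zero_of_mem_affineSpan (f : E →ᵃ[ℝ] ℝ) {B : Set E} (h : ∀ x ∈ B, f x = 0) {x : E}
    (hx : x ∈ affineSpan ℝ B) : f x = 0 := by
  refine affineSpan_induction hx h ?_
  · intro c u v w hu hv hw
    rw [vsub_eq_sub, vadd_eq_add, add_comm, affineMap_add_smul, affineMap_sub, hu, hv, hw]
    simp

lemma Irredundant.setOf_isFacet [Finite ι] [FiniteDimensional ℝ E] {g : ι → E →ᵃ[ℝ] ℝ}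
    (hg : Irredundant g) {z : E} (hz : ∀ i, 0 < g i z) (hE : 2 ≤ Module.finrank ℝ E) :
    {B | IsFacet (polyhedron g) B} = Set.range fun i => {x ∈ polyhedron g | g i x = 0} := by
  have hP := setDim_polyhedron g hz
  ext B
  constructor
  · rintro ⟨⟨hconv, hext⟩, hdim⟩
    rw [hP] at hdim
    have hne : B.Nonempty := by
      rw [Set.nonempty_iff_ne_empty]
      rintro rfl
      rw [setDim, AffineSubspace.span_empty, AffineSubspace.direction_bot, finrank_bot] at hdim
      omega
    obtain ⟨w, hw, hwB⟩ := exists_relint_point hconv hext.1 hne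
    obtain ⟨i, hi⟩ : ∃ i, g i w = 0 := by
      by_contra! hcon
      have : B = polyhedron g := hext.1.antisymm fun x hx =>
        mem_of_isExtreme_polyhedron hext hw hx fun j hj => absurd hj (hcon j)
      rw [this] at hdim
      omega
    have hsub : B ⊆ {x ∈ polyhedron g | g i x = 0} := fun x hx => ⟨hext.1 hx, hwB i hi x hx⟩
    refine ⟨i, (hsub.antisymm fun x hx => ?_).symm⟩
    have hle := affineSpan_mono ℝ hsub
    have heq : affineSpan ℝ B = affineSpan ℝ {x ∈ polyhedron g | g i x = 0} := by
      refine AffineSubspace.eq_of_direction_eq_of_nonempty_of_le ?_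
        ((affineSpan_nonempty ℝ).2 hne) hle
      refine Submodule.eq_of_le_of_finrank_eq (AffineSubspace.direction_le hle) ?_
      exact hdim.trans (hg.setDim_facet hz i).symm
    refine mem_of_isExtreme_polyhedron hext hw hx.1 fun j hj => ?_
    exact eq_zero_of_mem_affineSpan _ (hwB j hj) (heq ▸ subset_affineSpan ℝ _ hx)
  · rintro ⟨i, rfl⟩
    refine ⟨⟨?_, isExtreme_zero_polyhedron g i⟩, by rw [hP]; exact hg.setDim_facet hz i⟩
    rintro x ⟨hx, hx0⟩ y ⟨hy, hy0⟩ a b ha hb hab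
    refine ⟨convex_polyhedron g hx hy ha hb hab, ?_⟩
    rw [affineMap_combo _ _ _ hab, hx0, hy0]
    simp

lemma Irredundant.numFacets_eq [Fintype ι] [FiniteDimensional ℝ E] {g : ι → E →ᵃ[ℝ] ℝ}
    (hg : Irredundant g) {z : E} (hz : ∀ i, 0 < g i z) (hE : 2 ≤ Module.finrank ℝ E) :
    numFacets (polyhedron g) = Fintype.card ι := by
  rw [numFacets, hg.setOf_isFacet hz hE, Set.ncard_range_of_injective, Nat.card_eq_fintype_card]
  intro i j hij
  by_contra hne
  obtain ⟨w, hw, hwj⟩ := hg.exists_mem_facet hz i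
  have hwi : w ∈ {x ∈ polyhedron g | g i x = 0} := by
    refine ⟨fun k => ?_, hw⟩
    by_cases hk : k = i
    · exact hk ▸ hw.ge
    · exact (hwj k hk).le
  have : w ∈ {x ∈ polyhedron g | g j x = 0} := hij.le hwi
  exact (hwj j (Ne.symm hne)).ne' this.2

end Facets

section MinkowskiWeyl

variable {E F ι : Type*} [AddCommGroup E] [Module ℝ E] [AddCommGroup F] [Module ℝ F]

/-- `Q` is the solution set of finitely many affine inequalities. -/
def IsPolyhedral (Q : Set E) : Prop :=
  ∃ s : Set (E →ᵃ[ℝ] ℝ), s.Finite ∧ Q = {x | ∀ f ∈ s, 0 ≤ f x}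

lemma IsPolyhedral.preimage {Q : Set F} (hQ : IsPolyhedral Q) (T : E →ᵃ[ℝ] F) :
    IsPolyhedral (T ⁻¹' Q) := by
  obtain ⟨s, hs, rfl⟩ := hQ
  refine ⟨(fun f => f.comp T) '' s, hs.image _, ?_⟩
  ext x
  simp

lemma isPolyhedral_singleton_zero [FiniteDimensional ℝ E] : IsPolyhedral ({0} : Set E) := by
  let b := Module.finBasis ℝ E
  refine ⟨Set.range (fun i => (b.coord i).toAffineMap) ∪
    Set.range (fun i => (-b.coord i).toAffineMap),
    (Set.finite_range _).union (Set.finite_range _), ?_⟩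
  ext x
  simp only [Set.mem_singleton_iff, Set.mem_union, Set.mem_range, Set.mem_ofPred_eq]
  constructor
  · rintro rfl f (⟨i, rfl⟩ | ⟨i, rfl⟩) <;> simp
  · intro h
    refine b.ext_elem fun i => ?_
    have h1 := h _ (.inl ⟨i, rfl⟩)
    have h2 := h _ (.inr ⟨i, rfl⟩)
    simp only [LinearMap.coe_toAffineMap, LinearMap.neg_apply, Module.Basis.coord_apply] at h1 h2
    simp only [map_zero, Finsupp.coe_zero, Pi.zero_apply]
    linarith

lemma exists_between_of_finite {A B : Set ℝ} (hA : A.Finite) (hne : A.Nonempty)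
    (h : ∀ a ∈ A, ∀ b ∈ B, a ≤ b) : ∃ t, (∀ a ∈ A, a ≤ t) ∧ ∀ b ∈ B, t ≤ b :=
  ⟨sSup A, fun _ ha => le_csSup hA.bddAbove ha, fun b hb => csSup_le hne fun a ha => h a ha b hb⟩

/-- Fourier–Motzkin elimination. -/
lemma IsPolyhedral.add_ray {Q : Set E} (hQ : IsPolyhedral Q) (v : E) :
    IsPolyhedral {x | ∃ t : ℝ, 0 ≤ t ∧ x - t • v ∈ Q} := by
  obtain ⟨s, hs, rfl⟩ := hQ
  refine ⟨{f ∈ s | 0 ≤ f.linear v} ∪ Set.image2 (fun p q => p.linear v • q - q.linear v • p)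
    {f ∈ s | 0 < f.linear v} {f ∈ s | f.linear v < 0},
    (hs.sep _).union ((hs.sep _).image2 _ (hs.sep _)), ?_⟩
  have hsub : ∀ (f : E →ᵃ[ℝ] ℝ) x (t : ℝ), f (x - t • v) = f x - t * f.linear v := by
    intro f x t
    rw [sub_eq_add_neg, ← neg_smul, affineMap_add_smul]
    ring
  ext x
  simp only [Set.mem_ofPred_eq, hsub]
  constructor
  · rintro ⟨t, ht, h⟩ f (⟨hf, hfv⟩ | ⟨p, ⟨hp, hpv⟩, q, ⟨hq, hqv⟩, rfl⟩)
    · have := h f hf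
      nlinarith [mul_nonneg ht hfv]
    · have h1 := mul_nonneg hpv.le (h q hq)
      have h2 := mul_nonneg (neg_nonneg.2 hqv.le) (h p hp)
      simp only [AffineMap.coe_sub, AffineMap.coe_smul, Pi.sub_apply, Pi.smul_apply, smul_eq_mul]
      linarith
  · intro h
    obtain ⟨t, ht1, ht2⟩ := exists_between_of_finite
      (A := insert 0 ((fun q => q x / q.linear v) '' {f ∈ s | f.linear v < 0}))
      (B := (fun p => p x / p.linear v) '' {f ∈ s | 0 < f.linear v})
      (((hs.sep _).image _).insert _) (Set.insert_nonempty _ _) (by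
        rintro a (rfl | ⟨q, ⟨hq, hqv⟩, rfl⟩) _ ⟨p, ⟨hp, hpv⟩, rfl⟩
        · exact div_nonneg (h p (.inl ⟨hp, hpv.le⟩)) hpv.le
        · have := h _ (.inr ⟨p, ⟨hp, hpv⟩, q, ⟨hq, hqv⟩, rfl⟩)
          simp only [AffineMap.coe_sub,
            AffineMap.coe_smul, Pi.sub_apply, Pi.smul_apply, smul_eq_mul] at this
          rw [div_le_iff_of_neg hqv, div_mul_eq_mul_div, div_le_iff₀ hpv]
          linarith)
    refine ⟨t, ht1 0 (Set.mem_insert _ _), fun f hf => ?_⟩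
    rcases lt_trichotomy (f.linear v) 0 with hv | hv | hv
    · have := ht1 _ (Set.mem_insert_of_mem _ ⟨f, ⟨hf, hv⟩, rfl⟩)
      rw [div_le_iff_of_neg hv] at this
      linarith
    · have := h f (.inl ⟨hf, hv.ge⟩)
      rwa [hv, mul_zero, sub_zero]
    · have := ht2 _ ⟨f, ⟨hf, hv⟩, rfl⟩
      rw [le_div_iff₀ hv] at this
      linarith

open scoped NNReal in
lemma isPolyhedral_span [FiniteDimensional ℝ E] (S : Finset E) :
    IsPolyhedral (Submodule.span ℝ≥0 (S : Set E) : Set E) := by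
  classical
  induction S using Finset.induction_on with
  | empty => simpa using isPolyhedral_singleton_zero
  | insert v S _ ih =>
    convert ih.add_ray v
    ext x
    rw [Finset.coe_insert, SetLike.mem_coe, Submodule.mem_span_insert]
    constructor
    · rintro ⟨a, z, hz, rfl⟩
      exact ⟨a, a.2, by simpa [NNReal.smul_def] using hz⟩
    · rintro ⟨t, ht, hz⟩
      exact ⟨t.toNNReal, _, hz, by simp [NNReal.smul_def, Real.coe_toNNReal t ht]⟩

open scoped NNReal in
lemma mem_convexHull_iff_mem_span (S : Set E) (x : E) :
    x ∈ convexHull ℝ S ↔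
      (x, (1 : ℝ)) ∈ Submodule.span ℝ≥0 ((fun y : E => (y, (1 : ℝ))) '' S) := by
  constructor
  · intro hx
    set K := Submodule.span ℝ≥0 ((fun y : E => (y, (1 : ℝ))) '' S)
    have hconv : Convex ℝ {x : E | (x, (1 : ℝ)) ∈ K} := by
      intro y hy z hz a b ha hb hab
      have hy' : (y, (1 : ℝ)) ∈ K := hy
      have hz' : (z, (1 : ℝ)) ∈ K := hz
      have := K.add_mem (K.smul_mem a.toNNReal hy') (K.smul_mem b.toNNReal hz')
      simpa [NNReal.smul_def, Real.coe_toNNReal a ha, Real.coe_toNNReal b hb, hab] using this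
    refine convexHull_min (fun y hy => ?_) hconv hx
    exact Submodule.subset_span (Set.mem_image_of_mem (fun y : E => (y, (1 : ℝ))) hy)
  · intro hx
    have key : ∀ p ∈ Submodule.span ℝ≥0 ((fun y : E => (y, (1 : ℝ))) '' S),
        p = 0 ∨ 0 < p.2 ∧ ∃ y ∈ convexHull ℝ S, p.1 = p.2 • y := by
      intro p hp
      induction hp using Submodule.span_induction with
      | mem p hp =>
        obtain ⟨y, hy, rfl⟩ := hp
        exact .inr ⟨one_pos, y, subset_convexHull ℝ S hy, by simp⟩
      | zero => exact .inl rfl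
      | add p q _ _ hp hq =>
        rcases hp with rfl | ⟨hp, y, hy, hpy⟩
        · simpa using hq
        · rcases hq with rfl | ⟨hq, z, hz, hqz⟩
          · exact .inr (by simpa using ⟨hp, y, hy, hpy⟩)
          · have hpq : 0 < p.2 + q.2 := add_pos hp hq
            refine .inr ⟨hpq, (p.2 / (p.2 + q.2)) • y + (q.2 / (p.2 + q.2)) • z,
              convex_convexHull ℝ S hy hz (by positivity) (by positivity) (by field_simp), ?_⟩
            rw [Prod.fst_add, Prod.snd_add, hpy, hqz, smul_add, smul_smul, smul_smul,
              mul_div_cancel₀ _ hpq.ne', mul_div_cancel₀ _ hpq.ne']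
      | smul a p _ hp =>
        rcases hp with rfl | ⟨hp, y, hy, hpy⟩
        · exact .inl (smul_zero a)
        · rcases eq_zero_or_pos a with rfl | ha
          · exact .inl (zero_smul _ p)
          · refine .inr ⟨?_, y, hy, ?_⟩
            · rw [Prod.smul_snd, NNReal.smul_def, smul_eq_mul]
              exact mul_pos ha hp
            · rw [Prod.smul_fst, Prod.smul_snd, hpy, smul_assoc]
    rcases key _ hx with h | ⟨-, y, hy, h⟩
    · simp [Prod.ext_iff] at h
    · have hxy : x = y := by simpa using h
      exact hxy ▸ hy

lemma isPolyhedral_convexHull [FiniteDimensional ℝ E] (S : Finset E) :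
    IsPolyhedral (convexHull ℝ (S : Set E)) := by
  classical
  have h := (isPolyhedral_span (S.image fun y : E => (y, (1 : ℝ)))).preimage
    ((AffineMap.id ℝ E).prod (AffineMap.const ℝ E (1 : ℝ)))
  convert h
  ext x
  rw [mem_convexHull_iff_mem_span, Finset.coe_image]
  rfl

lemma polyhedron_subtype_eq (g : ι → E →ᵃ[ℝ] ℝ) (i : ι)
    (hi : ∀ y, g i y < 0 → ∃ j, j ≠ i ∧ g j y < 0) :
    polyhedron (fun j : {j // j ≠ i} => g j) = polyhedron g := by
  ext x
  refine ⟨fun hx => ?_, fun hx j => hx j⟩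
  have h0 : 0 ≤ g i x := by
    by_contra! hlt
    obtain ⟨j, hj, hjx⟩ := hi x hlt
    exact hjx.not_ge (hx ⟨j, hj⟩)
  intro j
  by_cases hj : j = i
  · exact hj ▸ h0
  · exact hx ⟨j, hj⟩

lemma exists_irredundant (ι : Type) [Fintype ι] (g : ι → E →ᵃ[ℝ] ℝ) :
    ∃ (κ : Type) (_ : Fintype κ) (k : κ → E →ᵃ[ℝ] ℝ),
      polyhedron k = polyhedron g ∧ Irredundant k := by
  classical
  induction hN : Fintype.card ι generalizing ι with
  | zero =>
    have := Fintype.card_eq_zero_iff.1 hN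
    exact ⟨ι, inferInstance, g, rfl, fun i => isEmptyElim i⟩
  | succ N ih =>
    by_cases hg : Irredundant g
    · exact ⟨ι, inferInstance, g, rfl, hg⟩
    · rw [Irredundant] at hg
      push Not at hg
      obtain ⟨i, hi⟩ := hg
      rw [← polyhedron_subtype_eq g i hi]
      exact ih {j // j ≠ i} _ (by rw [Fintype.card_subtype_compl, hN]; simp)

lemma exists_irredundant_convexHull [FiniteDimensional ℝ E] (S : Finset E) :
    ∃ (κ : Type) (_ : Fintype κ) (k : κ → E →ᵃ[ℝ] ℝ),
      polyhedron k = convexHull ℝ (S : Set E) ∧ Irredundant k := by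
  obtain ⟨s, hs, h⟩ := isPolyhedral_convexHull S
  have := hs.fintype
  obtain ⟨κ, hκ, k, hk, hirr⟩ := exists_irredundant (Fin (Fintype.card s))
    (fun i => ((Fintype.equivFin s).symm i : E →ᵃ[ℝ] ℝ))
  refine ⟨κ, hκ, k, hk.trans ?_, hirr⟩
  rw [h]
  ext x
  simp only [polyhedron, Set.mem_ofPred_eq, (Fintype.equivFin s).symm.forall_congr_left,
    Equiv.symm_symm, Equiv.symm_apply_apply, Subtype.forall]

lemma Irredundant.exists_interior_point [Finite ι] [FiniteDimensional ℝ E] {g : ι → E →ᵃ[ℝ] ℝ}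
    (hg : Irredundant g) (hne : (polyhedron g).Nonempty)
    (hdim : setDim (polyhedron g) = Module.finrank ℝ E) : ∃ z, ∀ i, 0 < g i z := by
  obtain ⟨w, hw, h⟩ := exists_relint_point (convex_polyhedron g) subset_rfl hne
  refine ⟨w, fun i => (hw i).lt_of_ne fun h0 => ?_⟩
  have htop : affineSpan ℝ (polyhedron g) = ⊤ :=
    (AffineSubspace.direction_eq_top_iff_of_nonempty ((affineSpan_nonempty ℝ).2 hne)).1
      (Submodule.eq_top_of_finrank_eq hdim)
  obtain ⟨y, hy, -⟩ := hg i
  exact hy.ne (eq_zero_of_mem_affineSpan _ (h i h0.symm) (htop ▸ trivial))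

lemma linearlyBounded_convexHull (S : Finset E) : LinearlyBounded (convexHull ℝ (S : Set E)) := by
  intro l
  obtain ⟨C, hC⟩ := (S.finite_toSet.image l).bddAbove
  refine ⟨C, fun x hx => ?_⟩
  exact convexHull_min (fun y hy => hC ⟨y, hy, rfl⟩) (convex_halfSpace_le l.isLinear C) hx

lemma finite_extremePoints_polyhedron [Finite ι] (g : ι → E →ᵃ[ℝ] ℝ) :
    (Set.extremePoints ℝ (polyhedron g)).Finite := by
  refine Set.Finite.of_injOn (f := fun u => {i | g i u = 0}) (t := Set.univ)
    (fun _ _ => trivial) ?_ Set.finite_univ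
  intro u hu v hv huv
  refine (sub_eq_zero.1 (eq_zero_of_mem_extremePoints_polyhedron g hu fun i hi => ?_)).symm
  have hi' : g i v = 0 := huv.le hi
  rw [affineMap_sub, hi, hi', sub_zero]

lemma exists_convexHull_eq_polyhedron [Finite ι] {d : ℕ} (g : ι → (Fin d → ℝ) →ᵃ[ℝ] ℝ)
    (hg : LinearlyBounded (polyhedron g)) :
    ∃ S : Finset (Fin d → ℝ), convexHull ℝ (S : Set (Fin d → ℝ)) = polyhedron g := by
  have hclosed : IsClosed (polyhedron g) := by
    have : polyhedron g = ⋂ i, {x | 0 ≤ g i x} := by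
      ext
      simp [polyhedron]
    rw [this]
    exact isClosed_iInter fun i =>
      isClosed_le continuous_const (g i).continuous_of_finiteDimensional
  choose C hC using fun i => hg (LinearMap.proj i)
  choose D hD using fun i => hg (-LinearMap.proj i)
  have hcompact : IsCompact (polyhedron g) := by
    refine (isCompact_Icc (a := -D) (b := C)).of_isClosed_subset hclosed fun x hx => ?_
    refine ⟨fun i => ?_, fun i => hC i x hx⟩
    have := hD i x hx
    simp only [LinearMap.neg_apply, LinearMap.proj_apply] at this
    simp only [Pi.neg_apply]
    linarith
  have hfin := finite_extremePoints_polyhedron g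
  refine ⟨hfin.toFinset, ?_⟩
  rw [hfin.coe_toFinset, ← (hfin.isClosed_convexHull ℝ).closure_eq]
  exact closure_convexHull_extremePoints hcompact (convex_polyhedron g)

end MinkowskiWeyl

section Hirsch

/-- Bounded polyhedra given by at most `dim + m` inequalities have diameter at most `m`. -/
def HirschBound (m : ℕ) : Prop :=
  ∀ (V : Type) [AddCommGroup V] [Module ℝ V] [FiniteDimensional ℝ V] (ι : Type) [Fintype ι]
    (g : ι → V →ᵃ[ℝ] ℝ), Fintype.card ι ≤ Module.finrank ℝ V + m →
    LinearlyBounded (polyhedron g) → DiamLE (polyhedron g) m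

/-- Polytopes of dimension `d ≥ 2` with exactly `2 * d` facets have diameter at most `d`. -/
def DStep : Prop :=
  ∀ d : ℕ, 2 ≤ d → ∀ S : Finset (Fin d → ℝ), S.Nonempty →
    setDim (convexHull ℝ (S : Set (Fin d → ℝ))) = d →
    numFacets (convexHull ℝ (S : Set (Fin d → ℝ))) = 2 * d →
    DiamLE (convexHull ℝ (S : Set (Fin d → ℝ))) d

lemma diamLE_one_of_finrank_eq_one {E : Type*} [AddCommGroup E] [Module ℝ E] {P : Set E}
    (hP : Convex ℝ P) (hE : Module.finrank ℝ E = 1) : DiamLE P 1 := by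
  intro a ha b hb
  by_cases hab : a = b
  · exact ⟨0, zero_le_one, fun _ => a, rfl, hab, by simp⟩
  have hne : b - a ≠ 0 := sub_ne_zero.2 (Ne.symm hab)
  have hseg : segment ℝ a b = P := by
    refine (hP.segment_subset ha.1 hb.1).antisymm fun x hx => ?_
    obtain ⟨c, hc⟩ := (finrank_eq_one_iff_of_nonzero' (b - a) hne).1 hE (x - a)
    have hxc : x = a + c • (b - a) := by rw [hc, add_sub_cancel]
    by_cases h0 : c < 0
    · have hpos : 0 < 1 - c := by linarith
      have hba := (mem_extremePoints.1 ha).2 x hx b hb.1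
        ⟨1 / (1 - c), -c / (1 - c), by positivity, div_pos (by linarith) hpos,
          by field_simp; ring, by
          rw [hxc]
          match_scalars <;> field_simp <;> ring⟩
      exact absurd hba.2.symm hab
    by_cases h1 : 1 < c
    · have hpos : 0 < c := by linarith
      have hba := (mem_extremePoints.1 hb).2 a ha.1 x hx
        ⟨(c - 1) / c, 1 / c, div_pos (by linarith) hpos, by positivity, by field_simp; ring, by
          rw [hxc]
          match_scalars <;> field_simp
          ring⟩
      exact absurd hba.1 hab
    · rw [segment_eq_image']
      exact ⟨c, ⟨not_lt.1 h0, not_lt.1 h1⟩, hxc.symm⟩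
  refine ⟨1, le_rfl, fun i => if i = 0 then a else b, rfl, rfl, fun i hi => ?_⟩
  obtain rfl : i = 0 := by omega
  exact ⟨hab, ha, hb, by simpa [hseg] using IsExtreme.refl ℝ P⟩

variable {V ι : Type} [AddCommGroup V] [Module ℝ V] [FiniteDimensional ℝ V] [Fintype ι]

lemma DStep.diamLE (h : DStep) (g : ι → V →ᵃ[ℝ] ℝ) (hg : Irredundant g) {z : V}
    (hz : ∀ i, 0 < g i z) (hb : LinearlyBounded (polyhedron g)) {m : ℕ} (hm : 2 ≤ m)
    (hV : Module.finrank ℝ V = m) (hι : Fintype.card ι = 2 * m) : DiamLE (polyhedron g) m := by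
  let L : V ≃ₗ[ℝ] (Fin m → ℝ) := LinearEquiv.ofFinrankEq _ _ (by simpa using hV)
  let T : (Fin m → ℝ) →ᵃ[ℝ] V := L.symm.toLinearMap.toAffineMap
  have hT : ∀ x, T x = L.symm x := fun _ => rfl
  have hTL : ∀ y, T (L y) = y := L.symm_apply_apply
  have hinj : Function.Injective T := L.symm.injective
  let k : ι → (Fin m → ℝ) →ᵃ[ℝ] ℝ := fun i => (g i).comp T
  have hk : ∀ i y, k i (L y) = g i y := fun i y => congrArg (g i) (hTL y)
  have him : T '' polyhedron k = polyhedron g := by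
    ext x
    constructor
    · rintro ⟨y, hy, rfl⟩
      exact hy
    · exact fun hx => ⟨L x, fun i => (hk i x).symm ▸ hx i, hTL x⟩
  have hkb : LinearlyBounded (polyhedron k) := by
    intro l
    obtain ⟨C, hC⟩ := hb (l.comp L.toLinearMap)
    refine ⟨C, fun x hx => ?_⟩
    have := hC (T x) (him.le ⟨x, hx, rfl⟩)
    simpa [hT] using this
  have hkirr : Irredundant k := fun i => by
    obtain ⟨y, hy, hyj⟩ := hg i
    exact ⟨L y, (hk i y).symm ▸ hy, fun j hj => (hk j y).symm ▸ hyj j hj⟩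
  have hkz : ∀ i, 0 < k i (L z) := fun i => (hk i z).symm ▸ hz i
  have hfr : Module.finrank ℝ (Fin m → ℝ) = m := by simp
  obtain ⟨S, hS⟩ := exists_convexHull_eq_polyhedron k hkb
  have hSne : S.Nonempty := by
    rw [← Finset.coe_nonempty, ← convexHull_nonempty_iff (𝕜 := ℝ), hS]
    exact ⟨L z, fun i => (hkz i).le⟩
  have hd : DiamLE (polyhedron k) m := by
    have := h m hm S hSne
    rw [hS] at this
    refine this ((setDim_polyhedron k hkz).trans hfr) ?_
    rw [hkirr.numFacets_eq hkz (hfr.symm ▸ hm), hι]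
  have hext : IsExtreme ℝ (polyhedron g) (T '' polyhedron k) := by
    rw [him]
  intro a ha b hb
  obtain ⟨a, ha', rfl⟩ := him.ge ha.1
  obtain ⟨b, hb', rfl⟩ := him.ge hb.1
  obtain ⟨l, hl, hp⟩ := hd a (mem_extremePoints_of_map_mem T hinj hext.1 ha' ha)
    b (mem_extremePoints_of_map_mem T hinj hext.1 hb' hb)
  obtain ⟨l', hl', hp'⟩ := hp.map T fun B => isExtreme_image_of_injective T hinj hext
  exact ⟨l', hl'.trans hl, hp'⟩

lemma diamLE_of_forall_pos (h : DStep) {m : ℕ} (ih : ∀ k < m, HirschBound k) (hm : 0 < m) (N : ℕ) :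
    ∀ (V : Type) [AddCommGroup V] [Module ℝ V] [FiniteDimensional ℝ V] (ι : Type) [Fintype ι]
      (g : ι → V →ᵃ[ℝ] ℝ) (z : V), (∀ i, 0 < g i z) → Fintype.card ι + N = 2 * m →
      Fintype.card ι ≤ Module.finrank ℝ V + m → LinearlyBounded (polyhedron g) →
      DiamLE (polyhedron g) m := by
  classical
  induction N with
  | zero =>
    intro V _ _ _ ι _ g z hz hN hcard hb
    by_cases hlt : Fintype.card ι < Module.finrank ℝ V + m
    · exact (ih (m - 1) (by omega) V ι g (by omega) hb).mono (Nat.sub_le _ _)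
    by_cases hg : Irredundant g
    · have hV : Module.finrank ℝ V = m := by omega
      rcases Nat.lt_or_ge 1 m with h1 | h1
      · exact h.diamLE g hg hz hb h1 hV hN
      · obtain rfl : m = 1 := by omega
        exact diamLE_one_of_finrank_eq_one (convex_polyhedron g) hV
    · rw [Irredundant] at hg
      push Not at hg
      obtain ⟨i, hi⟩ := hg
      rw [← polyhedron_subtype_eq g i hi] at hb ⊢
      refine (ih (m - 1) (by omega) V {j // j ≠ i} _ ?_ hb).mono (Nat.sub_le _ _)
      rw [Fintype.card_subtype_compl, Fintype.card_subtype_eq]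
      omega
  | succ N ihN =>
    intro V _ _ _ ι _ g z hz hN hcard hb
    by_cases hlt : Fintype.card ι < Module.finrank ℝ V + m
    · exact (ih (m - 1) (by omega) V ι g (by omega) hb).mono (Nat.sub_le _ _)
    obtain ⟨i⟩ : Nonempty ι := Fintype.card_pos_iff.1 (by omega)
    refine diamLE_of_wedge i ?_
    refine ihN (V × ℝ) (Option ι) (wedge g i) (z, g i z / 2) (wedge_pos g i hz) ?_ ?_ (hb.wedge i)
    · rw [Fintype.card_option]
      omega
    · rw [Fintype.card_option, Module.finrank_prod, Module.finrank_self]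
      omega

lemma hirschBound_of_dStep (h : DStep) (m : ℕ) : HirschBound m := by
  classical
  induction m using Nat.strong_induction_on with
  | _ m ih =>
  intro V _ _ _ ι _ g hcard hb
  induction hN : Fintype.card ι generalizing V ι with
  | zero =>
    intro u hu v hv
    have := Fintype.card_eq_zero_iff.1 hN
    have huv := eq_zero_of_mem_extremePoints_polyhedron g hu (v := u - v) fun i => isEmptyElim i
    exact ⟨0, Nat.zero_le _, fun _ => u, rfl, sub_eq_zero.1 huv, by simp⟩
  | succ N ihN =>
    intro u hu v hv
    by_cases hzero : ∃ i, g i u = 0 ∧ g i v = 0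
    · obtain ⟨i, hui, hvi⟩ := hzero
      refine exists_path_of_faceSystem i hu hv hui hvi ?_
      have hc : Fintype.card {j // j ≠ i} = N := by
        rw [Fintype.card_subtype_compl, Fintype.card_subtype_eq, hN, Nat.add_sub_cancel]
      have := finrank_le_finrank_ker_add_one (g i).linear
      exact ihN _ _ _ (by omega) (linearlyBounded_faceSystem hb i hui) hc
    · push Not at hzero
      have h1 := card_nonzero_add_finrank_le g hu
      have h2 := card_nonzero_add_finrank_le g hv
      have h3 : Fintype.card ι ≤ (Finset.univ.filter fun i => g i u ≠ 0).card +
          (Finset.univ.filter fun i => g i v ≠ 0).card := by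
        rw [← Finset.card_univ]
        refine (Finset.card_le_card fun i _ => ?_).trans (Finset.card_union_le _ _)
        by_cases hi : g i u = 0
        · simp [hi, hzero i hi]
        · simp [hi]
      have h4 : Fintype.card ι ≤ 2 * m := by omega
      exact diamLE_of_forall_pos h ih (by omega) (2 * m - Fintype.card ι) V ι g _
        (midpoint_pos_of_forall_ne_zero g hu.1 hv.1 hzero) (by omega) hcard hb u hu v hv

end Hirsch

/-- (Klee–Walkup) The `d`-step conjecture implies the Hirsch Conjecture: if every
`d`-dimensional polytope with `2d` facets has diameter at most `d`, then every
`d`-dimensional polytope with `n > d` facets has diameter at most `n - d`. -/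
theorem dstep_implies_hirsch
    (h : ∀ d : ℕ, 2 ≤ d → ∀ S : Finset (Fin d → ℝ), S.Nonempty →
      setDim (convexHull ℝ (S : Set (Fin d → ℝ))) = d →
      numFacets (convexHull ℝ (S : Set (Fin d → ℝ))) = 2 * d →
      ∀ a ∈ Set.extremePoints ℝ (convexHull ℝ (S : Set (Fin d → ℝ))),
        ∀ b ∈ Set.extremePoints ℝ (convexHull ℝ (S : Set (Fin d → ℝ))),
          ∃ L ≤ d, HasPathOfLength (convexHull ℝ (S : Set (Fin d → ℝ))) a b L) :
    ∀ d n : ℕ, 2 ≤ d → d < n → ∀ S : Finset (Fin d → ℝ), S.Nonempty →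
      setDim (convexHull ℝ (S : Set (Fin d → ℝ))) = d →
      numFacets (convexHull ℝ (S : Set (Fin d → ℝ))) = n →
      ∀ a ∈ Set.extremePoints ℝ (convexHull ℝ (S : Set (Fin d → ℝ))),
        ∀ b ∈ Set.extremePoints ℝ (convexHull ℝ (S : Set (Fin d → ℝ))),
          ∃ L ≤ n - d, HasPathOfLength (convexHull ℝ (S : Set (Fin d → ℝ))) a b L := by
  have hstep : DStep := h
  intro d n hd hdn S hS hdim hfac
  obtain ⟨κ, _, k, hk, hirr⟩ := exists_irredundant_convexHull S
  have hb := linearlyBounded_convexHull S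
  have hne : (convexHull ℝ (S : Set (Fin d → ℝ))).Nonempty :=
    convexHull_nonempty_iff.2 hS.to_set
  have hfr : Module.finrank ℝ (Fin d → ℝ) = d := by simp
  rw [← hk] at hb hne hdim hfac ⊢
  obtain ⟨z, hz⟩ := hirr.exists_interior_point hne (hdim.trans hfr.symm)
  have hcard := hirr.numFacets_eq hz (hfr.symm ▸ hd)
  exact hirschBound_of_dStep hstep (n - d) _ κ k (by omega) hb
end
end

section
/- (Klee–Walkup) In ℝ⁴ let a = (−3,3,1,2), b = (3,−3,1,2), c = (2,−1,1,3), d = (−2,1,1,3), e = (3,3,−1,2), f = (−3,−3,−1,2), g = (−1,−2,−1,3), h = (1,2,−1,3), w = (0,0,0,−2), and let Q = convexHull ℝ {a,b,c,d,e,f,g,h,w}. Then F₁ = convexHull ℝ {a,b,c,d} and F₂ = convexHull ℝ {e,f,g,h} are facets of Q, and in the dual graph of Q every path from F₁ to F₂ has length at least 5. -/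
open scoped BigOperators

noncomputable section

/-- Adjacency in the dual graph of a polytope `Q`: two distinct facets whose intersection is
a face of `Q` of dimension `dim Q - 2` (a ridge). -/
def DualAdj {E : Type*} [AddCommGroup E] [Module ℝ E] (Q F G : Set E) : Prop :=
  IsFacet Q F ∧ IsFacet Q G ∧ F ≠ G ∧ IsFace Q (F ∩ G) ∧ setDim (F ∩ G) = setDim Q - 2

/-- A path of length `L` in the dual graph of `Q` from the facet `F` to the facet `G`. -/
def DualPathOfLength {E : Type*} [AddCommGroup E] [Module ℝ E] (Q F G : Set E)
    (L : ℕ) : Prop :=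
  ∃ f : ℕ → Set E, f 0 = F ∧ f L = G ∧ ∀ i < L, DualAdj Q (f i) (f (i + 1))

open Finset in
/-- If a convex combination of points of `Q` lies in an extreme subset `F` of `Q`, then so does
every point occurring with positive weight. -/
theorem IsExtreme.mem_of_sum_smul_mem {E ι : Type*} [AddCommGroup E] [Module ℝ E] {Q F : Set E}
    (hQ : Convex ℝ Q) (hF : IsExtreme ℝ Q F) {t : Finset ι} {w : ι → ℝ} {z : ι → E}
    (hw₀ : ∀ i ∈ t, 0 ≤ w i) (hw₁ : ∑ i ∈ t, w i = 1) (hz : ∀ i ∈ t, z i ∈ Q)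
    (hmem : ∑ i ∈ t, w i • z i ∈ F) {j : ι} (hj : j ∈ t) (hwj : 0 < w j) : z j ∈ F := by
  classical
  -- Split off only half of the weight at `j`, so that the remaining weight is never zero.
  let v : ι → ℝ := fun i => w i - if i = j then w j / 2 else 0
  have hv₀ : ∀ i ∈ t, 0 ≤ v i := by
    intro i hi
    by_cases h : i = j
    · subst h; simp only [v, if_true]; linarith
    · simpa [v, h] using hw₀ i hi
  have hv₁ : ∑ i ∈ t, v i = 1 - w j / 2 := by
    simp [v, hw₁, hj]
  have hle : w j ≤ 1 := hw₁ ▸ single_le_sum hw₀ hj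
  have hpos : 0 < 1 - w j / 2 := by linarith
  have hvz : ∑ i ∈ t, v i • z i = ∑ i ∈ t, w i • z i - (w j / 2) • z j := by
    simp [v, sub_smul, ite_smul, hj]
  refine hF.left_mem_of_mem_openSegment (hz j hj)
    (hQ.centerMass_mem hv₀ (hv₁.symm ▸ hpos) hz) hmem
    ⟨w j / 2, 1 - w j / 2, by linarith, hpos, by ring, ?_⟩
  rw [centerMass, hv₁, smul_inv_smul₀ hpos.ne', hvz]
  abel

open Finset in
/-- In an affine dependence among points of `Q`, if all points with positive coefficient lie in a
face of `Q`, then so do all points with negative coefficient. -/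
theorem IsFace.mem_of_affine_dependence {E ι : Type*} [AddCommGroup E] [Module ℝ E] [Fintype ι]
    {Q F : Set E} (hQ : Convex ℝ Q) (hF : IsFace Q F) {c : ι → ℝ} {z : ι → E}
    (hz : ∀ i, z i ∈ Q) (hc : ∑ i, c i = 0) (hcz : ∑ i, c i • z i = 0)
    (hpos : ∀ i, 0 < c i → z i ∈ F) {j : ι} (hj : c j < 0) : z j ∈ F := by
  classical
  let I : Finset ι := {i | 0 < c i}
  let J : Finset ι := {i | ¬ 0 < c i}
  have hIJ : ∑ i ∈ I, c i + ∑ i ∈ J, c i = 0 := by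
    rw [sum_filter_add_sum_filter_not, hc]
  have hIJz : ∑ i ∈ I, c i • z i + ∑ i ∈ J, c i • z i = 0 := by
    rw [sum_filter_add_sum_filter_not, hcz]
  have hJ : ∀ i ∈ J, c i ≤ 0 := fun i hi => not_lt.1 (mem_filter.1 hi).2
  have hjJ : j ∈ J := mem_filter.2 ⟨mem_univ _, hj.not_gt⟩
  have hJneg : ∑ i ∈ J, c i < 0 := sum_neg' hJ ⟨j, hjJ, hj⟩
  have hmem : I.centerMass c z ∈ F :=
    hF.1.centerMass_mem (fun i hi => (mem_filter.1 hi).2.le) (by linarith)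
      fun i hi => hpos i (mem_filter.1 hi).2
  rw [← centerMass_of_sum_add_sum_eq_zero (by rw [add_comm]; exact hIJ)
    (by rw [add_comm]; exact hIJz), centerMass, smul_sum] at hmem
  simp only [smul_smul] at hmem
  refine hF.2.mem_of_sum_smul_mem hQ
    (fun i hi => mul_nonneg_of_nonpos_of_nonpos (inv_nonpos.2 hJneg.le) (hJ i hi))
    ?_ (fun i _ => hz i) hmem hjJ (mul_pos_of_neg_of_neg (inv_neg''.2 hJneg) hj)
  rw [← mul_sum, inv_mul_cancel₀ hJneg.ne]

/-- A face of a convex hull is the convex hull of the generators it contains. -/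
theorem IsFace.eq_convexHull_inter {E : Type*} [AddCommGroup E] [Module ℝ E] {V F : Set E}
    (hF : IsFace (convexHull ℝ V) F) : F = convexHull ℝ (F ∩ V) := by
  refine Set.Subset.antisymm (fun x hx => ?_) (convexHull_min Set.inter_subset_left hF.1)
  obtain ⟨ι, _, w, z, hw₀, hw₁, hz, rfl⟩ := mem_convexHull_iff_exists_fintype.1 (hF.2.subset hx)
  rw [← Finset.sum_subset (Finset.filter_subset (fun i => w i ≠ 0) Finset.univ)
    (fun i _ hi => by simp_all)]
  refine (convex_convexHull ℝ _).sum_mem (fun i _ => hw₀ i)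
    (by rwa [Finset.sum_filter_ne_zero]) fun i hi => subset_convexHull ℝ _ ⟨?_, hz i⟩
  exact hF.2.mem_of_sum_smul_mem (convex_convexHull ℝ V) (fun i _ => hw₀ i) hw₁
    (fun i _ => subset_convexHull ℝ V (hz i)) hx (Finset.mem_univ i)
    ((hw₀ i).lt_of_ne' (Finset.mem_filter.1 hi).2)

/-- A supporting hyperplane cuts out a face. -/
theorem isFace_setOf_eq {E : Type*} [AddCommGroup E] [Module ℝ E] {Q : Set E}
    (hQ : Convex ℝ Q) (l : E →ₗ[ℝ] ℝ) {m : ℝ} (hl : ∀ x ∈ Q, l x ≤ m) :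
    IsFace Q {x ∈ Q | l x = m} := by
  refine ⟨hQ.inter (convex_hyperplane l.isLinear m), fun x hx => hx.1, ?_⟩
  rintro x hx y hy _ ⟨-, hzm⟩ ⟨a, b, ha, hb, hab, rfl⟩
  refine ⟨hx, le_antisymm (hl x hx) ?_⟩
  simp only [map_add, map_smul, smul_eq_mul] at hzm
  have hx' : a * (m - l x) ≤ 0 := by
    have := mul_le_mul_of_nonneg_left (hl y hy) hb.le
    have : a * m + b * m = m := by rw [← add_mul, hab, one_mul]
    linarith
  linarith [nonpos_of_mul_nonpos_right hx' ha]

theorem setDim_convexHull {E : Type*} [AddCommGroup E] [Module ℝ E] (V : Set E) :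
    setDim (convexHull ℝ V) = Module.finrank ℝ (vectorSpan ℝ V) := by
  rw [setDim, affineSpan_convexHull, direction_affineSpan]

theorem setDim_convexHull_image_le {E ι : Type*} [AddCommGroup E] [Module ℝ E] (p : ι → E)
    (s : Finset ι) : setDim (convexHull ℝ (p '' s)) ≤ s.card - 1 := by
  classical
  rw [setDim_convexHull]
  rcases s.eq_empty_or_nonempty with rfl | hs
  · rw [Finset.coe_empty, Set.image_empty, vectorSpan_empty, finrank_bot]
    exact Nat.zero_le _
  · rw [← Finset.coe_image]
    exact finrank_vectorSpan_image_finset_le ℝ p s (Nat.sub_add_cancel hs.card_pos).symm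

/-- The indices of the points of the family `p` lying in `F`. -/
def indicesIn {E ι : Type*} [Fintype ι] (p : ι → E) (F : Set E) : Finset ι :=
  open Classical in {i | p i ∈ F}

theorem mem_indicesIn {E ι : Type*} [Fintype ι] {p : ι → E} {F : Set E} {i : ι} :
    i ∈ indicesIn p F ↔ p i ∈ F := by
  simp [indicesIn]

theorem indicesIn_inter {E ι : Type*} [Fintype ι] [DecidableEq ι] (p : ι → E) (F G : Set E) :
    indicesIn p (F ∩ G) = indicesIn p F ∩ indicesIn p G := by
  ext i
  simp [mem_indicesIn]

theorem IsFace.convexHull_image_indicesIn {E ι : Type*} [AddCommGroup E] [Module ℝ E] [Fintype ι]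
    {p : ι → E} {F : Set E} (hF : IsFace (convexHull ℝ (Set.range p)) F) :
    convexHull ℝ (p '' indicesIn p F) = F := by
  conv_rhs => rw [hF.eq_convexHull_inter]
  congr 1
  ext x
  constructor
  · rintro ⟨i, hi, rfl⟩
    exact ⟨mem_indicesIn.1 hi, i, rfl⟩
  · rintro ⟨hx, i, rfl⟩
    exact ⟨i, mem_indicesIn.2 hx, rfl⟩

theorem IsFace.setDim_le_card_sub_one {E ι : Type*} [AddCommGroup E] [Module ℝ E] [Fintype ι]
    {p : ι → E} {F : Set E} (hF : IsFace (convexHull ℝ (Set.range p)) F) :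
    setDim F ≤ (indicesIn p F).card - 1 := by
  conv_lhs => rw [← hF.convexHull_image_indicesIn]
  exact setDim_convexHull_image_le p _

namespace KleeWalkup

/-- The integer coordinates of the vertices `a, …, h, w`. -/
def coords : Fin 9 → Fin 4 → ℤ :=
  ![![-3, 3, 1, 2], ![3, -3, 1, 2], ![2, -1, 1, 3], ![-2, 1, 1, 3], ![3, 3, -1, 2],
    ![-3, -3, -1, 2], ![-1, -2, -1, 3], ![1, 2, -1, 3], ![0, 0, 0, -2]]

/-- The vertices `a, …, h, w` of the Klee–Walkup polytope. -/
def vertex (i : Fin 9) : Fin 4 → ℝ := fun k => coords i k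

/-- The Klee–Walkup polytope. -/
def polytope : Set (Fin 4 → ℝ) := convexHull ℝ (Set.range vertex)

theorem vertex_eq : vertex =
    ![![-3, 3, 1, 2], ![3, -3, 1, 2], ![2, -1, 1, 3], ![-2, 1, 1, 3], ![3, 3, -1, 2],
      ![-3, -3, -1, 2], ![-1, -2, -1, 3], ![1, 2, -1, 3], ![0, 0, 0, -2]] := by
  ext i k
  fin_cases i <;> fin_cases k <;> simp [vertex, coords]

theorem vertex_mem_polytope (i : Fin 9) : vertex i ∈ polytope :=
  subset_convexHull ℝ _ ⟨i, rfl⟩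

/-- Some of the minimal affine dependences among the vertices. -/
def circuits : List (Fin 9 → ℤ) :=
  [![1, 0, 0, 0, 6, 3, -1, -7, -2],
   ![3, 6, -7, -1, 1, 0, 0, 0, -2],
   ![6, 3, -1, -7, 0, 1, 0, 0, -2],
   ![0, 1, 0, 0, 3, 6, -7, -1, -2],
   ![0, 9, -13, 5, 2, -1, 0, 0, -2],
   ![9, 0, 5, -13, -1, 2, 0, 0, -2],
   ![1, -2, 0, 0, 0, -9, 13, -5, 2],
   ![2, -1, 0, 0, 9, 0, 5, -13, -2],
   ![0, 10, -17, 7, 0, -10, 11, -1, 0],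
   ![0, 10, -11, 1, -10, 0, -7, 17, 0],
   ![10, 0, 7, -17, -10, 0, -1, 11, 0],
   ![10, 0, 1, -11, 0, -10, 17, -7, 0]]

theorem circuits_sum_eq_zero : ∀ c ∈ circuits, ∑ i, c i = 0 := by
  decide +kernel

theorem circuits_sum_mul_coords_eq_zero :
    ∀ c ∈ circuits, ∀ k, ∑ i, c i * coords i k = 0 := by
  decide +kernel

/-- `S` contains the positive part of each circuit exactly when it contains its negative part. -/
def RespectsCircuits (S : Finset (Fin 9)) : Prop :=
  ∀ c ∈ circuits, (∀ i, 0 < c i → i ∈ S) ↔ ∀ i, c i < 0 → i ∈ S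

instance : DecidablePred RespectsCircuits := fun S =>
  inferInstanceAs (Decidable (∀ c ∈ circuits, (∀ i, 0 < c i → i ∈ S) ↔ ∀ i, c i < 0 → i ∈ S))

theorem respectsCircuits_indicesIn {F : Set (Fin 4 → ℝ)} (hF : IsFace polytope F) :
    RespectsCircuits (indicesIn vertex F) := by
  intro c hc
  have h₀ : ∑ i, (c i : ℝ) = 0 := mod_cast circuits_sum_eq_zero c hc
  have h₁ : ∑ i, (c i : ℝ) • vertex i = 0 := by
    ext k
    simpa [vertex] using mod_cast circuits_sum_mul_coords_eq_zero c hc k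
  simp only [mem_indicesIn]
  constructor
  · intro h i hi
    exact hF.mem_of_affine_dependence (convex_convexHull ℝ _) vertex_mem_polytope h₀ h₁
      (fun j hj => h j (mod_cast hj)) (mod_cast hi)
  · intro h i hi
    exact hF.mem_of_affine_dependence (c := fun i => -(c i : ℝ)) (convex_convexHull ℝ _)
      vertex_mem_polytope (by simpa using h₀) (by simpa using h₁)
      (fun j hj => h j (by simpa using hj)) (by simpa using hi)

/-- The possible vertex sets of facets sharing at least three vertices with `abcd`. -/
def nearStart : List (Finset (Fin 9)) :=
  [{0, 1, 2, 3}, {0, 2, 3, 4}, {1, 2, 3, 5}, {0, 1, 2, 8}, {0, 1, 3, 8}]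

/-- The possible vertex sets of facets sharing at least three vertices with `efgh`. -/
def nearEnd : List (Finset (Fin 9)) :=
  [{4, 5, 6, 7}, {1, 4, 6, 7}, {0, 5, 6, 7}, {4, 5, 6, 8}, {4, 5, 7, 8}]

theorem RespectsCircuits.card_eq_and_near : ∀ S : Finset (Fin 9), 4 ≤ S.card →
    S ≠ Finset.univ → RespectsCircuits S → S.card = 4 ∧
      (3 ≤ ({0, 1, 2, 3} ∩ S).card → S ∈ nearStart) ∧
      (3 ≤ (S ∩ {4, 5, 6, 7}).card → S ∈ nearEnd) := by
  decide +kernel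

theorem card_inter_le_one : ∀ A ∈ nearStart, ∀ B ∈ nearEnd, (A ∩ B).card ≤ 1 := by
  decide +kernel

theorem affineIndependent_abcdw : AffineIndependent ℝ (vertex ∘ ![0, 1, 2, 3, 8]) := by
  rw [affineIndependent_iff_of_fintype]
  intro u hu h
  rw [Finset.weightedVSub_eq_linear_combination _ hu, funext_iff] at h
  simp [Fin.sum_univ_succ, Fin.forall_fin_succ, vertex, coords] at h hu ⊢
  refine ⟨?_, ?_, ?_, ?_, ?_⟩ <;> linarith

theorem affineIndependent_efgh : AffineIndependent ℝ (vertex ∘ ![4, 5, 6, 7]) := by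
  rw [affineIndependent_iff_of_fintype]
  intro u hu h
  rw [Finset.weightedVSub_eq_linear_combination _ hu, funext_iff] at h
  simp [Fin.sum_univ_succ, Fin.forall_fin_succ, vertex, coords] at h hu ⊢
  refine ⟨?_, ?_, ?_, ?_⟩ <;> linarith

theorem affineIndependent_abcd : AffineIndependent ℝ (vertex ∘ ![0, 1, 2, 3]) := by
  convert affineIndependent_abcdw.comp_embedding Fin.castSuccEmb using 1
  ext i k
  fin_cases i <;> rfl

theorem setDim_polytope : setDim polytope = 4 := by
  rw [polytope, setDim_convexHull]
  refine le_antisymm ((Submodule.finrank_le _).trans_eq (by simp)) ?_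
  refine (affineIndependent_abcdw.finrank_vectorSpan (Fintype.card_fin 5)).symm.trans_le ?_
  exact Submodule.finrank_mono (vectorSpan_mono ℝ (Set.range_comp_subset_range _ _))

theorem isFacet_of_supporting {v : Fin 4 → Fin 9} (hv : AffineIndependent ℝ (vertex ∘ v))
    (l : (Fin 4 → ℝ) →ₗ[ℝ] ℝ) {m : ℝ} (hle : ∀ i, l (vertex i) ≤ m)
    (heq : ∀ i, l (vertex i) = m ↔ i ∈ Set.range v) :
    IsFacet polytope (convexHull ℝ (Set.range (vertex ∘ v))) := by
  have hl : ∀ x ∈ polytope, l x ≤ m :=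
    convexHull_min (Set.range_subset_iff.2 hle) (convex_halfSpace_le l.isLinear m)
  have hface : IsFace polytope {x ∈ polytope | l x = m} :=
    isFace_setOf_eq (convex_convexHull ℝ _) l hl
  have hset : convexHull ℝ (Set.range (vertex ∘ v)) = {x ∈ polytope | l x = m} := by
    rw [← IsFace.convexHull_image_indicesIn hface, Set.range_comp]
    congr 2
    ext i
    simpa [mem_indicesIn, vertex_mem_polytope] using (heq i).symm
  refine ⟨hset ▸ hface, ?_⟩
  rw [setDim_polytope, setDim_convexHull, hv.finrank_vectorSpan (Fintype.card_fin 4)]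

theorem isFacet_abcd : IsFacet polytope (convexHull ℝ (Set.range (vertex ∘ ![0, 1, 2, 3]))) := by
  refine isFacet_of_supporting affineIndependent_abcd (LinearMap.proj 2) (m := 1) ?_ ?_ <;>
    (simp [Fin.forall_fin_succ, vertex, coords]; try norm_num)

theorem isFacet_efgh : IsFacet polytope (convexHull ℝ (Set.range (vertex ∘ ![4, 5, 6, 7]))) := by
  refine isFacet_of_supporting affineIndependent_efgh (-LinearMap.proj 2) (m := 1) ?_ ?_ <;>
    (simp [Fin.forall_fin_succ, vertex, coords]; try norm_num)

theorem card_indicesIn_eq_and_near {F : Set (Fin 4 → ℝ)} (hF : IsFacet polytope F) :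
    (indicesIn vertex F).card = 4 ∧
      (3 ≤ ({0, 1, 2, 3} ∩ indicesIn vertex F).card → indicesIn vertex F ∈ nearStart) ∧
      (3 ≤ (indicesIn vertex F ∩ {4, 5, 6, 7}).card → indicesIn vertex F ∈ nearEnd) := by
  have hdim : setDim F = 3 := by rw [hF.2, setDim_polytope]
  refine RespectsCircuits.card_eq_and_near _ ?_ ?_ (respectsCircuits_indicesIn hF.1)
  · have := IsFace.setDim_le_card_sub_one hF.1
    omega
  · intro h
    have hFQ : F = polytope := by
      rw [← IsFace.convexHull_image_indicesIn hF.1, h, Finset.coe_univ, Set.image_univ, polytope]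
    rw [hFQ, setDim_polytope] at hdim
    omega

theorem indicesIn_convexHull_range {v : Fin 4 → Fin 9} (hv : Function.Injective v)
    (hF : IsFacet polytope (convexHull ℝ (Set.range (vertex ∘ v)))) :
    indicesIn vertex (convexHull ℝ (Set.range (vertex ∘ v))) =
      Finset.univ.map ⟨v, hv⟩ := by
  refine (Finset.eq_of_subset_of_card_le (fun i hi => ?_) ?_).symm
  · obtain ⟨j, -, rfl⟩ := Finset.mem_map.1 hi
    exact mem_indicesIn.2 (subset_convexHull ℝ _ ⟨j, rfl⟩)
  · simp [(card_indicesIn_eq_and_near hF).1]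

theorem three_le_card_inter {F G : Set (Fin 4 → ℝ)} (h : DualAdj polytope F G) :
    3 ≤ (indicesIn vertex F ∩ indicesIn vertex G).card := by
  obtain ⟨-, -, -, hface, hdim⟩ := h
  have := IsFace.setDim_le_card_sub_one hface
  rw [hdim, setDim_polytope, indicesIn_inter] at this
  omega

theorem two_le_card_inter {α : Type*} [DecidableEq α] {A B C : Finset α} (hB : B.card = 4)
    (hAB : 3 ≤ (A ∩ B).card) (hBC : 3 ≤ (B ∩ C).card) : 2 ≤ (A ∩ C).card := by
  have hunion : ((A ∩ B) ∪ (B ∩ C)).card ≤ B.card :=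
    Finset.card_le_card (Finset.union_subset Finset.inter_subset_right Finset.inter_subset_left)
  have hinter : ((A ∩ B) ∩ (B ∩ C)).card ≤ (A ∩ C).card :=
    Finset.card_le_card
      (Finset.inter_subset_inter Finset.inter_subset_left Finset.inter_subset_right)
  have := Finset.card_union_add_card_inter (A ∩ B) (B ∩ C)
  omega

theorem five_le_of_dualPath {F G : Set (Fin 4 → ℝ)} (hF : IsFacet polytope F)
    (hFi : indicesIn vertex F = {0, 1, 2, 3})
    (hGi : indicesIn vertex G = {4, 5, 6, 7}) {L : ℕ} (h : DualPathOfLength polytope F G L) :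
    5 ≤ L := by
  obtain ⟨f, rfl, rfl, hadj⟩ := h
  by_contra! hL
  -- Make the path stationary from time `L` on, so that it reaches its end at time `4`.
  let g : ℕ → Set (Fin 4 → ℝ) := fun i => f (min i L)
  have hg : ∀ i, IsFacet polytope (g i) := by
    intro i
    rcases Nat.eq_zero_or_pos (min i L) with h₀ | h₀
    · simpa only [g, h₀] using hF
    · have := (hadj (min i L - 1) (by omega)).2.1
      rwa [Nat.sub_add_cancel h₀] at this
  have hstep : ∀ i, 3 ≤ (indicesIn vertex (g i) ∩ indicesIn vertex (g (i + 1))).card := by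
    intro i
    rcases lt_or_ge i L with hi | hi
    · simpa [g, min_eq_left hi.le, min_eq_left (Nat.succ_le_of_lt hi)] using
        three_le_card_inter (hadj i hi)
    · have : g (i + 1) = g i := by simp [g, min_eq_right hi, min_eq_right (hi.trans i.le_succ)]
      rw [this, Finset.inter_self, (card_indicesIn_eq_and_near (hg i)).1]
      omega
  have h₀ : indicesIn vertex (g 0) = {0, 1, 2, 3} := by simpa [g] using hFi
  have h₄ : indicesIn vertex (g 4) = {4, 5, 6, 7} := by
    simpa [g, min_eq_right (Nat.le_of_lt_succ hL)] using hGi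
  have h₁ := (card_indicesIn_eq_and_near (hg 1)).2.1 (h₀ ▸ hstep 0)
  have h₃ := (card_indicesIn_eq_and_near (hg 3)).2.2 (h₄ ▸ hstep 3)
  exact absurd (card_inter_le_one _ h₁ _ h₃) (not_le.2
    (two_le_card_inter (card_indicesIn_eq_and_near (hg 2)).1 (hstep 1) (hstep 2)))

end KleeWalkup

open KleeWalkup in
/-- (Klee–Walkup) In the Klee–Walkup 4-polytope `Q₄`, the facets `conv{a,b,c,d}` and
`conv{e,f,g,h}` are at distance at least `5` in the dual graph. -/
theorem klee_walkup_Q4 :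
    let pa : Fin 4 → ℝ := ![-3, 3, 1, 2]
    let pb : Fin 4 → ℝ := ![3, -3, 1, 2]
    let pc : Fin 4 → ℝ := ![2, -1, 1, 3]
    let pd : Fin 4 → ℝ := ![-2, 1, 1, 3]
    let pe : Fin 4 → ℝ := ![3, 3, -1, 2]
    let pf : Fin 4 → ℝ := ![-3, -3, -1, 2]
    let pg : Fin 4 → ℝ := ![-1, -2, -1, 3]
    let ph : Fin 4 → ℝ := ![1, 2, -1, 3]
    let pw : Fin 4 → ℝ := ![0, 0, 0, -2]
    let Q : Set (Fin 4 → ℝ) :=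
      convexHull ℝ {pa, pb, pc, pd, pe, pf, pg, ph, pw}
    let F₁ : Set (Fin 4 → ℝ) := convexHull ℝ {pa, pb, pc, pd}
    let F₂ : Set (Fin 4 → ℝ) := convexHull ℝ {pe, pf, pg, ph}
    IsFacet Q F₁ ∧ IsFacet Q F₂ ∧
      ∀ L : ℕ, DualPathOfLength Q F₁ F₂ L → 5 ≤ L := by
  intro pa pb pc pd pe pf pg ph pw Q F₁ F₂
  have hQ : Q = polytope := by
    simp only [Q, polytope, vertex_eq, Matrix.range_cons, Matrix.range_empty, Set.union_empty,
      Set.singleton_union, pa, pb, pc, pd, pe, pf, pg, ph, pw]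
  have hF₁ : F₁ = convexHull ℝ (Set.range (vertex ∘ ![0, 1, 2, 3])) := by
    refine congrArg (convexHull ℝ) (Set.ext fun x => ?_)
    simp [Fin.exists_fin_succ, vertex_eq, pa, pb, pc, pd, @eq_comm _ x]
  have hF₂ : F₂ = convexHull ℝ (Set.range (vertex ∘ ![4, 5, 6, 7])) := by
    refine congrArg (convexHull ℝ) (Set.ext fun x => ?_)
    simp [Fin.exists_fin_succ, vertex_eq, pe, pf, pg, ph, @eq_comm _ x]
  rw [hQ, hF₁, hF₂]
  refine ⟨isFacet_abcd, isFacet_efgh, fun L => five_le_of_dualPath isFacet_abcd ?_ ?_⟩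
  · rw [indicesIn_convexHull_range (by decide) isFacet_abcd]
    decide
  · rw [indicesIn_convexHull_range (by decide) isFacet_efgh]
    decide
end
end
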